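/- Let T > 0 and n ≥ 1. Let (X_i(t))_{t∈[0,T]}, i = 1,…,n, be independent centered Gaussian processes with almost surely continuous sample paths such that E[X_i(t)X_i(s)] = 2^{−K_i}((t^{2H_i}+s^{2H_i})^{K_i} − |t−s|^{2K_iH_i}) (bifractional Brownian motion covariances) with parameters K_i ∈ (0,1], H_i ∈ (0,1) satisfying 1/2 < K_1H_1 < K_2H_2 ≤ ⋯ ≤ K_nH_n. Let λ_i > 0, and let g : [0,T] → ℝ be a bounded measurable function such that |g(T) − g(t)| ≤ M(T−t) for all t ∈ [ν, T], for some constants M and ν ∈ (0,T). Then lim_{u→∞} P(sup_{t∈[0,T]}(∑_{i=1}^n λ_i X_i(t) − g(t)) > u) / Ψ((u+g(T))/(∑_{i=1}^n λ_i² T^{2K_iH_i})^{1/2}) = 1. -/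

import Mathlib

open MeasureTheory ProbabilityTheory Filter Set

/-- The standard normal tail function `Ψ(x) = P(Z > x)`. -/
noncomputable def stdNormalTail (x : ℝ) : ℝ := ((gaussianReal 0 1) (Set.Ioi x)).toReal

/-- A centered Gaussian process on `[0,T]`: every finite linear combination of its
values is a centered Gaussian random variable. -/
def IsCenteredGaussianProcess {Ω : Type*} [MeasurableSpace Ω] (P : Measure Ω)
    (T : ℝ) (X : ℝ → Ω → ℝ) : Prop :=
  (∀ t ∈ Set.Icc (0:ℝ) T, Measurable (X t)) ∧
    ∀ (k : ℕ) (c : Fin k → ℝ) (t : Fin k → ℝ), (∀ j, t j ∈ Set.Icc (0:ℝ) T) →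
      ∃ v : NNReal, Measure.map (fun ω => ∑ j, c j * X (t j) ω) P = gaussianReal 0 v

lemma stdNormalTail_eq_integral (x : ℝ) :
    stdNormalTail x = ∫ t in Ioi x, gaussianPDFReal 0 1 t := by
  rw [stdNormalTail, gaussianReal_apply_eq_integral 0 one_ne_zero,
    ENNReal.toReal_ofReal (integral_nonneg fun t => gaussianPDFReal_nonneg 0 1 t)]

lemma continuous_gaussianPDFReal_std : Continuous (gaussianPDFReal 0 1) := by
  unfold gaussianPDFReal
  fun_prop

lemma stdNormalTail_sub (x y : ℝ) :
    stdNormalTail x - stdNormalTail y = ∫ t in x..y, gaussianPDFReal 0 1 t := by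
  rw [stdNormalTail_eq_integral, stdNormalTail_eq_integral,
    ← intervalIntegral.integral_interval_add_Ioi (b := y)
      (integrable_gaussianPDFReal 0 1).integrableOn
      (integrable_gaussianPDFReal 0 1).integrableOn]
  ring

lemma stdNormalTail_nonneg (x : ℝ) : 0 ≤ stdNormalTail x := ENNReal.toReal_nonneg

lemma stdNormalTail_antitone : Antitone stdNormalTail := fun x y hxy => by
  have h := stdNormalTail_sub x y
  have : 0 ≤ ∫ t in x..y, gaussianPDFReal 0 1 t :=
    intervalIntegral.integral_nonneg hxy fun t _ => gaussianPDFReal_nonneg 0 1 t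
  linarith

lemma hasDerivAt_stdNormalTail (x : ℝ) :
    HasDerivAt stdNormalTail (-gaussianPDFReal 0 1 x) x := by
  have h1 : stdNormalTail = fun y => stdNormalTail 0 - ∫ t in (0:ℝ)..y, gaussianPDFReal 0 1 t := by
    funext y
    rw [← stdNormalTail_sub]
    ring
  rw [h1]
  have h2 := intervalIntegral.integral_hasDerivAt_right (f := gaussianPDFReal 0 1)
    (continuous_gaussianPDFReal_std.intervalIntegrable 0 x)
    (continuous_gaussianPDFReal_std.stronglyMeasurableAtFilter _ _)
    continuous_gaussianPDFReal_std.continuousAt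
  simpa using h2.const_sub (stdNormalTail 0)

lemma gaussianPDFReal_std_le_of_le {x y : ℝ} (hx : 0 ≤ x) (hxy : x ≤ y) :
    gaussianPDFReal 0 1 y ≤ gaussianPDFReal 0 1 x := by
  unfold gaussianPDFReal
  gcongr

/-- A crude Mills ratio bound. -/
lemma gaussianPDFReal_le_mul_stdNormalTail_of_nonneg {z : ℝ} (hz : 0 ≤ z) :
    gaussianPDFReal 0 1 z ≤ 5 * (z + 1) * stdNormalTail z := by
  set a := 1 / (z + 1) with ha
  have hz1 : 0 < z + 1 := by linarith
  have ha0 : 0 < a := by positivity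
  have ha1 : a ≤ 1 := by rw [ha, div_le_one hz1]; linarith
  have haz : z * a ≤ 1 := by rw [ha, mul_one_div, div_le_one hz1]; linarith
  have hmul : (z + 1) * a = 1 := by rw [ha]; field_simp
  have h1 : a * gaussianPDFReal 0 1 (z + a) ≤ stdNormalTail z := by
    have h2 := stdNormalTail_sub z (z + a)
    have h3 : ∫ t in z..(z + a), gaussianPDFReal 0 1 (z + a) ≤
        ∫ t in z..(z + a), gaussianPDFReal 0 1 t := by
      refine intervalIntegral.integral_mono_on (by linarith) (by simp)
        (continuous_gaussianPDFReal_std.intervalIntegrable _ _) fun t ht => ?_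
      exact gaussianPDFReal_std_le_of_le (hz.trans ht.1) ht.2
    simp at h3
    linarith [stdNormalTail_nonneg (z + a)]
  have h4 : gaussianPDFReal 0 1 z ≤ 5 * gaussianPDFReal 0 1 (z + a) := by
    have h5 : Real.exp (-(3 / 2)) * 5 ≥ 1 := by
      have h6 : Real.exp (3 / 2) ≤ 5 := by
        have h7 : Real.exp (3 / 2) ^ 2 = Real.exp 1 ^ 3 := by
          rw [← Real.exp_nat_mul, ← Real.exp_nat_mul]; norm_num
        have h8 := Real.exp_one_lt_d9
        have h9 : Real.exp 1 ^ 3 ≤ 2.72 ^ 3 := by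
          gcongr
          linarith
        nlinarith [Real.exp_pos (3 / 2)]
      rw [Real.exp_neg, ge_iff_le, inv_mul_eq_div, one_le_div (Real.exp_pos _)]
      exact h6
    have h10 : gaussianPDFReal 0 1 z * Real.exp (-(3 / 2)) ≤ gaussianPDFReal 0 1 (z + a) := by
      unfold gaussianPDFReal
      rw [mul_assoc, ← Real.exp_add]
      gcongr
      simp only [sub_zero, NNReal.coe_one, mul_one]
      nlinarith
    nlinarith [gaussianPDFReal_nonneg 0 1 z]
  calc gaussianPDFReal 0 1 z ≤ 5 * gaussianPDFReal 0 1 (z + a) := h4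
    _ = 5 * (z + 1) * (a * gaussianPDFReal 0 1 (z + a)) := by
      linear_combination (-5 * gaussianPDFReal 0 1 (z + a)) * hmul
    _ ≤ _ := by gcongr

lemma gaussianPDFReal_le_mul_stdNormalTail {x z : ℝ} (hx : 0 ≤ x) (hzx : z ≤ x) :
    gaussianPDFReal 0 1 z ≤ 5 * (x + 1) * stdNormalTail z := by
  rcases le_total 0 z with hz | hz
  · refine (gaussianPDFReal_le_mul_stdNormalTail_of_nonneg hz).trans ?_
    have := stdNormalTail_nonneg z
    gcongr
  · have h1 := gaussianPDFReal_le_mul_stdNormalTail_of_nonneg le_rfl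
    have h2 : gaussianPDFReal 0 1 z ≤ gaussianPDFReal 0 1 0 := by
      simp only [gaussianPDFReal, sub_zero]
      refine mul_le_mul_of_nonneg_left (Real.exp_le_exp.mpr ?_) (by positivity)
      simp only [NNReal.coe_one, mul_one]
      nlinarith
    have h3 := stdNormalTail_antitone hz
    nlinarith [stdNormalTail_nonneg z]

lemma stdNormalTail_pos_of_nonneg {x : ℝ} (hx : 0 ≤ x) : 0 < stdNormalTail x := by
  have h1 := gaussianPDFReal_le_mul_stdNormalTail_of_nonneg hx
  have h2 := gaussianPDFReal_pos 0 1 x one_ne_zero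
  by_contra h
  have h3 : stdNormalTail x = 0 := le_antisymm (not_lt.mp h) (stdNormalTail_nonneg x)
  rw [h3] at h1
  linarith

/-- The hazard rate of the normal law controls how fast its tail grows to the left. -/
lemma stdNormalTail_sub_le {x h : ℝ} (hx : 0 ≤ x) (hh : 0 ≤ h) :
    stdNormalTail (x - h) ≤ Real.exp (5 * (x + 1) * h) * stdNormalTail x := by
  set κ := 5 * (x + 1) with hκ
  have hderiv : ∀ z, HasDerivAt (fun z => Real.exp (κ * z) * stdNormalTail z)
      (Real.exp (κ * z) * κ * stdNormalTail z + Real.exp (κ * z) * (-gaussianPDFReal 0 1 z)) z := by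
    intro z
    have h1 : HasDerivAt (fun z => Real.exp (κ * z)) (Real.exp (κ * z) * κ) z := by
      simpa using ((hasDerivAt_id z).const_mul κ).exp
    exact h1.mul (hasDerivAt_stdNormalTail z)
  have hmono : MonotoneOn (fun z => Real.exp (κ * z) * stdNormalTail z) (Iic x) := by
    refine monotoneOn_of_deriv_nonneg (convex_Iic x)
      (fun z _ => (hderiv z).continuousAt.continuousWithinAt)
      (fun z _ => (hderiv z).differentiableAt.differentiableWithinAt) fun z hz => ?_
    rw [(hderiv z).deriv]
    rw [interior_Iic] at hz
    have := gaussianPDFReal_le_mul_stdNormalTail hx (le_of_lt hz)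
    have h2 := Real.exp_pos (κ * z)
    nlinarith
  have h3 := hmono (show x - h ∈ Iic x by simpa using hh) (show x ∈ Iic x by simp) (by linarith)
  simp only at h3
  have h4 : Real.exp (κ * x) = Real.exp (κ * (x - h)) * Real.exp (κ * h) := by
    rw [← Real.exp_add]; ring_nf
  rw [h4, mul_assoc (Real.exp _)] at h3
  exact le_of_mul_le_mul_left h3 (Real.exp_pos _)

lemma exp_le_mul_stdNormalTail {x : ℝ} (hx : 0 ≤ x) :
    Real.exp (-x ^ 2 / 2) ≤ 5 * √(2 * Real.pi) * (x + 1) * stdNormalTail x := by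
  have h1 := gaussianPDFReal_le_mul_stdNormalTail_of_nonneg hx
  have h2 : 0 < √(2 * Real.pi) := by positivity
  simp only [gaussianPDFReal, NNReal.coe_one, mul_one, sub_zero] at h1
  rw [inv_mul_le_iff₀ h2] at h1
  linarith

lemma gaussianReal_Ioi_eq_stdNormalTail {v : NNReal} (hv : v ≠ 0) (x : ℝ) :
    gaussianReal 0 v (Ioi x) = ENNReal.ofReal (stdNormalTail (x / √v)) := by
  have hs : 0 < √(v : ℝ) := Real.sqrt_pos.mpr (by positivity)
  have h := gaussianReal_map_const_mul (μ := 0) (v := 1) √(v : ℝ)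
  have h2 : (NNReal.mk (√(v : ℝ) ^ 2) (sq_nonneg _)) * 1 = v := by
    ext; simp
  rw [h2, mul_zero] at h
  rw [← h, Measure.map_apply (by fun_prop) measurableSet_Ioi, stdNormalTail,
    ENNReal.ofReal_toReal (measure_ne_top _ _)]
  congr 1
  ext y
  simp [div_lt_iff₀ hs, mul_comm]

/-- The dyadic approximation from below of `t`, at level `k`. -/
noncomputable def dyadicFloor (k : ℕ) (t : ℝ) : ℝ := ⌊2 ^ k * t⌋₊ / 2 ^ k

lemma dyadicFloor_mem_Icc {t : ℝ} (ht : t ∈ Icc (0 : ℝ) 1) (k : ℕ) :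
    dyadicFloor k t ∈ Icc (0 : ℝ) 1 := by
  refine ⟨by unfold dyadicFloor; positivity, ?_⟩
  unfold dyadicFloor
  rw [div_le_one (by positivity)]
  have h : (0 : ℝ) ≤ 2 ^ k * t := mul_nonneg (by positivity) ht.1
  have h2 : (2 : ℝ) ^ k * t ≤ 2 ^ k * 1 := by gcongr; exact ht.2
  linarith [Nat.floor_le h]

lemma tendsto_dyadicFloor {t : ℝ} (ht : 0 ≤ t) :
    Tendsto (fun k => dyadicFloor k t) atTop (nhds t) := by
  have h := (tendsto_nat_floor_mul_div_atTop ht).comp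
    (tendsto_pow_atTop_atTop_of_one_lt (one_lt_two : (1 : ℝ) < 2))
  refine h.congr fun k => ?_
  simp [dyadicFloor, mul_comm]

/-- Two points whose dyadic floors are equal or adjacent have images controlled by the
dyadic increments of level `k`. -/
lemma abs_sub_le_of_floor_le_add_one {f : ℝ → ℝ} {B : ℝ} (hB : 0 ≤ B) {k : ℕ}
    (hd : ∀ j : ℕ, j < 2 ^ k → |f ((j + 1) / 2 ^ k) - f (j / 2 ^ k)| ≤ B)
    {i j : ℕ} (hij : i ≤ j) (hj : j ≤ i + 1) (hj2 : j ≤ 2 ^ k) :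
    |f (j / 2 ^ k) - f (i / 2 ^ k)| ≤ B := by
  rcases Nat.lt_or_ge i j with h | h
  · obtain rfl : j = i + 1 := by omega
    simpa using hd i (by omega)
  · obtain rfl : j = i := by omega
    simpa using hB

lemma exists_holder_const_of_dyadic {ρ : ℝ} (hρ : 0 < ρ) :
    ∃ C > 0, ∀ (f : ℝ → ℝ) (A : ℝ), 0 ≤ A → ContinuousOn f (Icc 0 1) →
      (∀ k j : ℕ, j < 2 ^ k →
        |f ((j + 1) / 2 ^ k) - f (j / 2 ^ k)| ≤ A * ((2 : ℝ) ^ (-ρ)) ^ k) →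
      ∀ s ∈ Icc (0 : ℝ) 1, ∀ t ∈ Icc (0 : ℝ) 1, |f t - f s| ≤ C * A * |t - s| ^ ρ := by
  set q : ℝ := (2 : ℝ) ^ (-ρ) with hq
  have hq0 : 0 < q := by positivity
  have hq1 : q < 1 := Real.rpow_lt_one_of_one_lt_of_neg one_lt_two (by linarith)
  have hq1' : 0 < 1 - q := by linarith
  refine ⟨(1 + 2 / (1 - q)) * q⁻¹, by positivity, fun f A hA hf hd => ?_⟩
  have hfloor_le : ∀ t ∈ Icc (0 : ℝ) 1, ∀ k : ℕ, ⌊(2 : ℝ) ^ k * t⌋₊ ≤ 2 ^ k := by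
    intro t ht k
    have h2 : (2 : ℝ) ^ k * t ≤ 2 ^ k * 1 := by gcongr; exact ht.2
    refine (Nat.floor_le_floor h2).trans ?_
    rw [mul_one, show (2 : ℝ) ^ k = ((2 ^ k : ℕ) : ℝ) by push_cast; rfl, Nat.floor_natCast]
  have hstep : ∀ t ∈ Icc (0 : ℝ) 1, ∀ k,
      dist (f (dyadicFloor k t)) (f (dyadicFloor (k + 1) t)) ≤ A * q ^ k := by
    intro t ht k
    have h0 : (0 : ℝ) ≤ 2 ^ k * t := mul_nonneg (by positivity) ht.1
    have h0' : (0 : ℝ) ≤ 2 ^ (k + 1) * t := mul_nonneg (by positivity) ht.1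
    have h1 : 2 * ⌊(2 : ℝ) ^ k * t⌋₊ ≤ ⌊(2 : ℝ) ^ (k + 1) * t⌋₊ := by
      rw [Nat.le_floor_iff h0']
      push_cast
      rw [pow_succ]
      linarith [Nat.floor_le h0]
    have h2 : ⌊(2 : ℝ) ^ (k + 1) * t⌋₊ ≤ 2 * ⌊(2 : ℝ) ^ k * t⌋₊ + 1 := by
      rw [← Nat.lt_succ_iff, Nat.floor_lt h0']
      push_cast
      rw [pow_succ]
      linarith [Nat.lt_floor_add_one ((2 : ℝ) ^ k * t)]
    have h3 := abs_sub_le_of_floor_le_add_one (B := A * q ^ (k + 1)) (by positivity)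
      (hd (k + 1)) h1 h2 (hfloor_le t ht (k + 1))
    have h4 : ((2 * ⌊(2 : ℝ) ^ k * t⌋₊ : ℕ) : ℝ) / 2 ^ (k + 1) = dyadicFloor k t := by
      unfold dyadicFloor
      push_cast
      field_simp
      ring
    rw [h4] at h3
    rw [dist_comm, Real.dist_eq]
    refine h3.trans ?_
    have : q ^ (k + 1) ≤ q ^ k := pow_le_pow_of_le_one hq0.le hq1.le (Nat.le_succ k)
    gcongr
  have happrox : ∀ t ∈ Icc (0 : ℝ) 1, ∀ k,
      |f (dyadicFloor k t) - f t| ≤ A * q ^ k / (1 - q) := by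
    intro t ht k
    have htend : Tendsto (fun k => f (dyadicFloor k t)) atTop (nhds (f t)) :=
      (hf t ht).tendsto.comp (tendsto_nhdsWithin_iff.mpr
        ⟨tendsto_dyadicFloor ht.1, .of_forall (dyadicFloor_mem_Icc ht)⟩)
    exact dist_le_of_le_geometric_of_tendsto q A hq1 (hstep t ht) htend k
  have key : ∀ s ∈ Icc (0 : ℝ) 1, ∀ t ∈ Icc (0 : ℝ) 1, s < t →
      |f t - f s| ≤ (1 + 2 / (1 - q)) * q⁻¹ * A * |t - s| ^ ρ := by
    intro s hs t ht hst
    obtain ⟨m, hm1, hm2⟩ := exists_nat_pow_near_of_lt_one (x := t - s) (y := (1 / 2 : ℝ))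
      (by linarith) (by linarith [hs.1, ht.2]) (by norm_num) (by norm_num)
    have h0 : (0 : ℝ) ≤ 2 ^ m * s := mul_nonneg (by positivity) hs.1
    have h0' : (0 : ℝ) ≤ 2 ^ m * t := mul_nonneg (by positivity) ht.1
    have hclose : (2 : ℝ) ^ m * t ≤ 2 ^ m * s + 1 := by
      have : (2 : ℝ) ^ m * (t - s) ≤ 2 ^ m * (1 / 2) ^ m := by gcongr
      rw [← mul_pow] at this
      norm_num at this
      linarith
    have h1 : ⌊(2 : ℝ) ^ m * s⌋₊ ≤ ⌊(2 : ℝ) ^ m * t⌋₊ := Nat.floor_le_floor (by gcongr)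
    have h2 : ⌊(2 : ℝ) ^ m * t⌋₊ ≤ ⌊(2 : ℝ) ^ m * s⌋₊ + 1 := by
      rw [← Nat.floor_add_one h0]
      exact Nat.floor_le_floor hclose
    have h3 : |f (dyadicFloor m t) - f (dyadicFloor m s)| ≤ A * q ^ m :=
      abs_sub_le_of_floor_le_add_one (by positivity) (hd m) h1 h2 (hfloor_le t ht m)
    have h4 := happrox t ht m
    have h5 := happrox s hs m
    have hqm : q ^ m ≤ q⁻¹ * |t - s| ^ ρ := by
      rw [le_inv_mul_iff₀ hq0, ← pow_succ', abs_of_pos (by linarith)]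
      have : q ^ (m + 1) = ((1 / 2 : ℝ) ^ (m + 1)) ^ ρ := by
        rw [hq, ← Real.rpow_natCast, ← Real.rpow_mul (by norm_num), one_div, ← Real.rpow_natCast,
          ← Real.rpow_mul (by norm_num), Real.inv_rpow (by norm_num), ← Real.rpow_neg (by norm_num)]
        ring_nf
      rw [this]
      gcongr
    calc |f t - f s| ≤ A * q ^ m / (1 - q) + A * q ^ m + A * q ^ m / (1 - q) := by
          rw [abs_le] at h3 h4 h5 ⊢
          constructor <;> linarith
      _ = (1 + 2 / (1 - q)) * A * q ^ m := by ring
      _ ≤ (1 + 2 / (1 - q)) * A * (q⁻¹ * |t - s| ^ ρ) := by gcongr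
      _ = _ := by ring
  intro s hs t ht
  rcases lt_trichotomy s t with h | h | h
  · exact key s hs t ht h
  · subst h
    simp
    positivity
  · rw [abs_sub_comm, abs_sub_comm t s]
    exact key t ht s hs h

section Chaining

lemma lintegral_exp_mul_sq_gaussianReal_le {v : NNReal} {β : ℝ} (h : β * v ≤ 1 / 4) :
    ∫⁻ x, ENNReal.ofReal (Real.exp (β * x ^ 2)) ∂(gaussianReal 0 v) ≤ 2 := by
  by_cases hv : v = 0
  · subst hv
    simp
  have hv' : (0 : ℝ) < v := by positivity
  rw [gaussianReal_of_var_ne_zero _ hv,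
    lintegral_withDensity_eq_lintegral_mul _ (measurable_gaussianPDF 0 v) (by fun_prop)]
  calc ∫⁻ x, (gaussianPDF 0 v * fun x => ENNReal.ofReal (Real.exp (β * x ^ 2))) x
      ≤ ∫⁻ x, 2 * gaussianPDF 0 (2 * v) x := by
        refine lintegral_mono fun x => ?_
        simp only [Pi.mul_apply, gaussianPDF]
        rw [← ENNReal.ofReal_mul (gaussianPDFReal_nonneg _ _ _),
          show (2 : ENNReal) = ENNReal.ofReal 2 by simp, ← ENNReal.ofReal_mul (by norm_num)]
        refine ENNReal.ofReal_le_ofReal ?_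
        simp only [gaussianPDFReal, sub_zero, NNReal.coe_mul, NNReal.coe_ofNat]
        rw [mul_assoc, ← Real.exp_add, ← mul_assoc]
        have h1 : (√(2 * Real.pi * v))⁻¹ ≤ 2 * (√(2 * Real.pi * (2 * v)))⁻¹ := by
          rw [show 2 * Real.pi * (2 * (v : ℝ)) = 2 * (2 * Real.pi * v) by ring,
            Real.sqrt_mul zero_le_two, mul_inv, ← mul_assoc]
          have h0 : (0 : ℝ) ≤ (√(2 * Real.pi * v))⁻¹ := by positivity
          have h3 : (1 : ℝ) ≤ 2 * (√2)⁻¹ := by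
            rw [← div_eq_mul_inv, one_le_div (by positivity), Real.sqrt_le_left (by norm_num)]
            norm_num
          exact le_mul_of_one_le_left h0 h3
        have h2 : -x ^ 2 / (2 * v) + β * x ^ 2 ≤ -x ^ 2 / (2 * (2 * v)) := by
          have h3 : β * x ^ 2 ≤ 1 / (4 * v) * x ^ 2 := by
            gcongr
            rw [le_div_iff₀ (by positivity)]
            linarith
          have h4 : -x ^ 2 / (2 * v) + 1 / (4 * v) * x ^ 2 = -x ^ 2 / (2 * (2 * v)) := by
            field_simp
            ring
          linarith
        gcongr
    _ = 2 := by
        rw [lintegral_const_mul _ (measurable_gaussianPDF _ _),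
          lintegral_gaussianPDF_eq_one 0 (by simpa using hv), mul_one]

lemma summable_two_pow_mul_exp_neg_pow {a : ℝ} (ha : 1 < a) :
    Summable (fun k : ℕ => (2 : ℝ) ^ k * Real.exp (-a ^ k)) := by
  obtain ⟨m, hm⟩ := pow_unbounded_of_one_lt 4 ha
  have ha0 : 0 < a := by linarith
  refine Summable.of_nonneg_of_le (fun k => by positivity) (fun k => ?_)
    ((summable_geometric_of_lt_one (r := 1 / 2) (by norm_num) (by norm_num)).mul_left
      (m.factorial : ℝ))
  have h1 := Real.pow_div_factorial_le_exp (a ^ k) (by positivity) m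
  have h2 : (4 : ℝ) ^ k ≤ (a ^ k) ^ m := by
    rw [← pow_mul, mul_comm, pow_mul]
    gcongr
  rw [Real.exp_neg, ← div_eq_mul_inv, div_le_iff₀ (Real.exp_pos _)]
  have h3 : (4 : ℝ) ^ k / m.factorial ≤ Real.exp (a ^ k) := le_trans (by gcongr) h1
  calc (2 : ℝ) ^ k = m.factorial * (1 / 2) ^ k * (4 ^ k / m.factorial) := by
        rw [show (4 : ℝ) = 2 * 2 by norm_num, mul_pow]
        field_simp
        rw [← mul_pow]; norm_num
    _ ≤ _ := by gcongr

variable {Ω : Type*} [MeasurableSpace Ω] {P : Measure Ω}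

/-- The Hölder constant of a Gaussian process on `[0,1]` has a Gaussian tail. -/
lemma exists_holder_exp_integrable_unit [IsProbabilityMeasure P] {Y : ℝ → Ω → ℝ} {α ρ C : ℝ}
    (hρ : 0 < ρ) (hρα : 2 * ρ < α) (hC : 0 < C)
    (hmeas : ∀ t ∈ Icc (0 : ℝ) 1, Measurable (Y t))
    (hG : ∀ s ∈ Icc (0 : ℝ) 1, ∀ t ∈ Icc (0 : ℝ) 1, ∃ v : NNReal,
      P.map (fun ω => Y t ω - Y s ω) = gaussianReal 0 v ∧ (v : ℝ) ≤ C * |t - s| ^ α)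
    (hcont : ∀ᵐ ω ∂P, ContinuousOn (fun t => Y t ω) (Icc 0 1)) :
    ∃ N : Ω → ℝ, Measurable N ∧ (∀ ω, 0 ≤ N ω) ∧
      (∃ η > 0, Integrable (fun ω => Real.exp (η * N ω ^ 2)) P) ∧
      ∀ᵐ ω ∂P, ∀ s ∈ Icc (0 : ℝ) 1, ∀ t ∈ Icc (0 : ℝ) 1,
        |Y t ω - Y s ω| ≤ N ω * |t - s| ^ ρ := by
  obtain ⟨c, hc, hholder⟩ := exists_holder_const_of_dyadic hρ
  set q : ℝ := (2 : ℝ) ^ (-ρ) with hq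
  have hq0 : 0 < q := by positivity
  set a : ℝ := (2 : ℝ) ^ (α - 2 * ρ) with ha
  have ha0 : 0 < a := by positivity
  have ha1 : 1 < a := Real.one_lt_rpow one_lt_two (by linarith)
  have hpow : ∀ k : ℕ, ((1 : ℝ) / 2 ^ k) ^ α = (q ^ k) ^ 2 * (a ^ k)⁻¹ := by
    intro k
    rw [hq, ha, one_div, ← Real.rpow_natCast, ← Real.rpow_natCast, ← Real.rpow_natCast,
      ← Real.rpow_natCast, ← Real.rpow_mul (by positivity), ← Real.rpow_mul (by positivity),
      ← Real.rpow_mul (by positivity), Real.inv_rpow (by positivity),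
      ← Real.rpow_mul (by positivity), ← Real.rpow_neg (by positivity),
      ← Real.rpow_neg (by positivity), ← Real.rpow_add (by positivity)]
    congr 1
    push_cast
    ring
  set Δ : ℕ → ℕ → Ω → ℝ := fun k j ω => Y ((j + 1) / 2 ^ k) ω - Y (j / 2 ^ k) ω with hΔ
  have hgrid : ∀ k j : ℕ, j ≤ 2 ^ k → ((j : ℝ) / 2 ^ k) ∈ Icc (0 : ℝ) 1 := by
    intro k j hj
    refine ⟨by positivity, ?_⟩
    rw [div_le_one (by positivity)]
    exact_mod_cast hj
  have hgrid' : ∀ k j : ℕ, j < 2 ^ k → (((j : ℝ) + 1) / 2 ^ k) ∈ Icc (0 : ℝ) 1 := by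
    intro k j hj
    exact_mod_cast hgrid k (j + 1) hj
  have hΔmeas : ∀ k j, j < 2 ^ k → Measurable (Δ k j) := fun k j hj =>
    (hmeas _ (hgrid' k j hj)).sub (hmeas _ (hgrid k j hj.le))
  set η : ℝ := 1 / (8 * C) with hη
  have hη0 : 0 < η := by positivity
  set A : ℕ → ℕ → Ω → ℝ := fun k j ω => Δ k j ω ^ 2 / (q ^ k) ^ 2 with hA
  set F : ℕ → ℕ → Ω → ENNReal := fun k j ω =>
    ENNReal.ofReal (Real.exp (a ^ k / (4 * C) * A k j ω - (a ^ k / (4 * C) - η) * (8 * C)))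
    with hF
  have hFmeas : ∀ k j, j < 2 ^ k → Measurable (F k j) := by
    intro k j hj
    have := hΔmeas k j hj
    simp only [hF, hA]
    fun_prop
  have hFint : ∀ k j, j < 2 ^ k →
      ∫⁻ ω, F k j ω ∂P ≤ ENNReal.ofReal (2 * Real.exp (-a ^ k)) := by
    intro k j hj
    obtain ⟨v, hv, hvC⟩ := hG _ (hgrid k j hj.le) _ (hgrid' k j hj)
    have hvC' : (v : ℝ) ≤ C * ((q ^ k) ^ 2 * (a ^ k)⁻¹) := by
      rw [← hpow]
      refine hvC.trans_eq ?_
      rw [show ((j : ℝ) + 1) / 2 ^ k - j / 2 ^ k = 1 / 2 ^ k by ring, abs_of_pos (by positivity)]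
    have hβ : a ^ k / (4 * C) / (q ^ k) ^ 2 * v ≤ 1 / 4 := by
      calc a ^ k / (4 * C) / (q ^ k) ^ 2 * v
          ≤ a ^ k / (4 * C) / (q ^ k) ^ 2 * (C * ((q ^ k) ^ 2 * (a ^ k)⁻¹)) := by gcongr
        _ = 1 / 4 := by field_simp
    have hint := lintegral_exp_mul_sq_gaussianReal_le hβ
    rw [← hv, lintegral_map (by fun_prop) (hΔmeas k j hj)] at hint
    have hak : 1 ≤ a ^ k := one_le_pow₀ ha1.le
    have hle : ∀ ω, F k j ω ≤ ENNReal.ofReal (Real.exp (-a ^ k)) *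
        ENNReal.ofReal (Real.exp (a ^ k / (4 * C) / (q ^ k) ^ 2 * (Δ k j ω) ^ 2)) := by
      intro ω
      rw [← ENNReal.ofReal_mul (Real.exp_pos _).le, ← Real.exp_add]
      refine ENNReal.ofReal_le_ofReal (Real.exp_le_exp.mpr ?_)
      have e1 : (a ^ k / (4 * C) - η) * (8 * C) = 2 * a ^ k - 1 := by
        rw [hη]; field_simp; ring
      have e2 : a ^ k / (4 * C) * A k j ω = a ^ k / (4 * C) / (q ^ k) ^ 2 * (Δ k j ω) ^ 2 := by
        simp only [hA]; ring
      rw [e1, e2]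
      linarith
    calc ∫⁻ ω, F k j ω ∂P ≤ ∫⁻ ω, ENNReal.ofReal (Real.exp (-a ^ k)) *
        ENNReal.ofReal (Real.exp (a ^ k / (4 * C) / (q ^ k) ^ 2 * (Δ k j ω) ^ 2)) ∂P :=
          lintegral_mono hle
      _ ≤ ENNReal.ofReal (Real.exp (-a ^ k)) * 2 := by
          rw [lintegral_const_mul' _ _ ENNReal.ofReal_ne_top]
          gcongr
      _ = _ := by
          rw [mul_comm, ENNReal.ofReal_mul (by norm_num)]
          simp
  set G : Ω → ENNReal := fun ω => ENNReal.ofReal (Real.exp (η * (8 * C))) +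
    ∑' k, ∑ j ∈ Finset.range (2 ^ k), F k j ω with hGdef
  have hsumMeas : ∀ k, Measurable fun ω => ∑ j ∈ Finset.range (2 ^ k), F k j ω := fun k =>
    Finset.measurable_fun_sum _ fun j hj => hFmeas k j (Finset.mem_range.mp hj)
  have hGmeas : Measurable G := measurable_const.add (Measurable.tsum hsumMeas)
  have hGint : ∫⁻ ω, G ω ∂P ≠ ⊤ := by
    simp only [hGdef]
    rw [lintegral_add_left measurable_const, lintegral_tsum fun k => (hsumMeas k).aemeasurable]
    refine ENNReal.add_ne_top.mpr ⟨by simp, ?_⟩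
    have hle : ∀ k, ∫⁻ ω, ∑ j ∈ Finset.range (2 ^ k), F k j ω ∂P ≤
        ENNReal.ofReal (2 * (2 ^ k * Real.exp (-a ^ k))) := by
      intro k
      rw [lintegral_finsetSum' _
        fun j hj => (hFmeas k j (Finset.mem_range.mp hj)).aemeasurable]
      refine (Finset.sum_le_sum fun j hj => hFint k j (Finset.mem_range.mp hj)).trans ?_
      rw [Finset.sum_const, Finset.card_range, nsmul_eq_mul,
        show ((2 ^ k : ℕ) : ENNReal) = ENNReal.ofReal (2 ^ k) by
          rw [ENNReal.ofReal_pow (by norm_num)]; simp,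
        ← ENNReal.ofReal_mul (by positivity)]
      refine ENNReal.ofReal_le_ofReal (le_of_eq (by ring))
    exact ne_top_of_le_ne_top ((summable_two_pow_mul_exp_neg_pow ha1).mul_left 2).tsum_ofReal_ne_top
      (ENNReal.tsum_le_tsum hle)
  have hGge : ∀ ω, ∀ k j, j < 2 ^ k → ENNReal.ofReal (Real.exp (η * A k j ω)) ≤ G ω := by
    intro ω k j hj
    have hak : 1 ≤ a ^ k := one_le_pow₀ ha1.le
    rcases le_total (A k j ω) (8 * C) with h | h
    · refine le_trans (ENNReal.ofReal_le_ofReal ?_) (le_add_right le_rfl)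
      gcongr
    · refine le_trans (b := F k j ω) (ENNReal.ofReal_le_ofReal ?_) (le_add_left ?_)
      · gcongr
        have h1 : 0 ≤ a ^ k / (4 * C) - η := by
          rw [hη, sub_nonneg, div_le_div_iff₀ (by positivity) (by positivity)]
          nlinarith
        nlinarith
      · refine le_trans ?_ (ENNReal.le_tsum k)
        exact Finset.single_le_sum (f := fun j => F k j ω) (fun _ _ => zero_le)
          (Finset.mem_range.mpr hj)
  have hGlt : ∀ᵐ ω ∂P, G ω < ⊤ := ae_lt_top hGmeas hGint
  have hG1 : ∀ ω, 1 ≤ G ω := by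
    intro ω
    refine le_trans ?_ (le_add_right le_rfl)
    rw [← ENNReal.ofReal_one]
    exact ENNReal.ofReal_le_ofReal (Real.one_le_exp (by positivity))
  set N₀ : Ω → ℝ := fun ω => √(Real.log (G ω).toReal / η) with hN₀
  have hlog : ∀ ω, 0 ≤ Real.log (G ω).toReal := by
    intro ω
    by_cases h : G ω = ⊤
    · simp [h]
    · refine Real.log_nonneg ?_
      rw [← ENNReal.toReal_one]
      exact ENNReal.toReal_mono h (hG1 ω)
  have hN₀sq : ∀ ω, η * N₀ ω ^ 2 = Real.log (G ω).toReal := by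
    intro ω
    rw [hN₀]
    simp only
    rw [Real.sq_sqrt (div_nonneg (hlog ω) hη0.le)]
    field_simp
  have hN₀meas : Measurable N₀ := by
    have := hGmeas.ennreal_toReal
    fun_prop
  refine ⟨fun ω => c * N₀ ω, by fun_prop, fun ω => by positivity,
    ⟨η / c ^ 2, by positivity, ?_⟩, ?_⟩
  · have e : ∀ ω, η / c ^ 2 * (c * N₀ ω) ^ 2 = η * N₀ ω ^ 2 := fun ω => by field_simp
    simp only [e]
    refine (integrable_toReal_of_lintegral_ne_top hGmeas.aemeasurable hGint).congr ?_
    filter_upwards [hGlt] with ω hω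
    rw [hN₀sq, Real.exp_log]
    exact ENNReal.toReal_pos (zero_lt_one.trans_le (hG1 ω)).ne' hω.ne
  · filter_upwards [hGlt, hcont] with ω hω hωc
    refine hholder (fun t => Y t ω) (N₀ ω) (Real.sqrt_nonneg _) hωc fun k j hj => ?_
    have h1 := ENNReal.toReal_mono hω.ne (hGge ω k j hj)
    rw [ENNReal.toReal_ofReal (Real.exp_pos _).le] at h1
    have h2 : η * A k j ω ≤ η * N₀ ω ^ 2 := by
      rw [hN₀sq, Real.le_log_iff_exp_le]
      · exact h1
      · exact (Real.exp_pos _).trans_le h1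
    have h3 := le_of_mul_le_mul_left h2 hη0
    simp only [hA] at h3
    rw [div_le_iff₀ (by positivity), ← mul_pow] at h3
    exact abs_le_of_sq_le_sq h3 (by positivity)

/-- The Hölder constant of a Gaussian process on `[0,T]` has a Gaussian tail. -/
lemma exists_holder_exp_integrable [IsProbabilityMeasure P] {Y : ℝ → Ω → ℝ} {T α ρ C : ℝ}
    (hT : 0 < T) (hρ : 0 < ρ) (hρα : 2 * ρ < α) (hC : 0 < C)
    (hmeas : ∀ t ∈ Icc (0 : ℝ) T, Measurable (Y t))
    (hG : ∀ s ∈ Icc (0 : ℝ) T, ∀ t ∈ Icc (0 : ℝ) T, ∃ v : NNReal,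
      P.map (fun ω => Y t ω - Y s ω) = gaussianReal 0 v ∧ (v : ℝ) ≤ C * |t - s| ^ α)
    (hcont : ∀ᵐ ω ∂P, ContinuousOn (fun t => Y t ω) (Icc 0 T)) :
    ∃ N : Ω → ℝ, Measurable N ∧ (∀ ω, 0 ≤ N ω) ∧
      (∃ η > 0, Integrable (fun ω => Real.exp (η * N ω ^ 2)) P) ∧
      ∀ᵐ ω ∂P, ∀ s ∈ Icc (0 : ℝ) T, ∀ t ∈ Icc (0 : ℝ) T,
        |Y t ω - Y s ω| ≤ N ω * |t - s| ^ ρ := by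
  have hmaps : MapsTo (fun x => T * x) (Icc (0 : ℝ) 1) (Icc 0 T) := fun x hx =>
    ⟨mul_nonneg hT.le hx.1, mul_le_of_le_one_right hT.le hx.2⟩
  obtain ⟨N, hN, hN0, ⟨η, hη, hint⟩, hH⟩ := exists_holder_exp_integrable_unit
    (P := P) (Y := fun x => Y (T * x)) (C := C * T ^ α) hρ hρα (by positivity)
    (fun x hx => hmeas _ (hmaps hx))
    (fun x hx y hy => by
      obtain ⟨v, hv, hvC⟩ := hG _ (hmaps hx) _ (hmaps hy)
      refine ⟨v, hv, hvC.trans_eq ?_⟩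
      rw [← mul_sub, abs_mul, abs_of_pos hT, Real.mul_rpow hT.le (abs_nonneg _)]
      ring)
    (by
      filter_upwards [hcont] with ω hω
      exact hω.comp (by fun_prop) hmaps)
  refine ⟨fun ω => N ω * (T⁻¹) ^ ρ, by fun_prop, fun ω => mul_nonneg (hN0 ω) (by positivity),
    ⟨η / ((T⁻¹) ^ ρ) ^ 2, by positivity, ?_⟩, ?_⟩
  · refine hint.congr (.of_forall fun ω => ?_)
    have : (T⁻¹) ^ ρ ≠ 0 := by positivity
    simp only
    congr 1
    field_simp
  · filter_upwards [hH] with ω hω s hs t ht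
    have hdiv : ∀ x ∈ Icc (0 : ℝ) T, T⁻¹ * x ∈ Icc (0 : ℝ) 1 := fun x hx =>
      ⟨mul_nonneg (by positivity) hx.1, by rw [inv_mul_le_iff₀ hT]; linarith [hx.2]⟩
    have h := hω _ (hdiv s hs) _ (hdiv t ht)
    simp only [mul_inv_cancel_left₀ hT.ne'] at h
    rwa [← mul_sub, abs_mul, abs_of_pos (inv_pos.mpr hT),
      Real.mul_rpow (by positivity) (abs_nonneg _), ← mul_assoc] at h

end Chaining

section Asymptotics

variable {Ω : Type*} [MeasurableSpace Ω] {P : Measure Ω}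

lemma le_ciSup_of_denseRange {a b : ℝ} {d : ℕ → Icc a b} (hd : DenseRange d) {f : ℝ → ℝ}
    (hf : ContinuousOn f (Icc a b)) (hbdd : BddAbove (range fun n => f (d n))) {t : ℝ}
    (ht : t ∈ Icc a b) : f t ≤ ⨆ n, f (d n) := by
  have hclosed : IsClosed {x : Icc a b | f x ≤ ⨆ n, f (d n)} :=
    isClosed_le (continuousOn_iff_continuous_domRestrict.mp hf) continuous_const
  exact hd.induction_on (p := fun x : Icc a b => f x ≤ ⨆ n, f (d n)) ⟨t, ht⟩ hclosed
    fun n => le_ciSup hbdd n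

/-- A Hölder bound of order above `1/2` beats a steep linear drift. -/
lemma mul_rpow_sub_le_sq {N ρ b v s δ : ℝ} (hρ : 1 / 2 < ρ) (hb : 0 < b) (hv : 0 < v)
    (hs : s ∈ Icc 0 δ) :
    N * s ^ ρ - b * v * s ≤ N ^ 2 * δ ^ (2 * ρ - 1) / (4 * b) / v := by
  have hδ : 0 ≤ δ := hs.1.trans hs.2
  have h1 : (N * s ^ ρ - b * v * s) * v ≤ N ^ 2 * s ^ (2 * ρ - 1) / (4 * b) := by
    rcases hs.1.eq_or_lt with h | h
    · subst h
      rw [Real.zero_rpow (by linarith), Real.zero_rpow (by linarith)]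
      simp
    · set p := s ^ (ρ - 1 / 2) with hp
      set w := s ^ (1 / 2 : ℝ) with hw
      have e1 : s ^ ρ = p * w := by rw [hp, hw, ← Real.rpow_add h]; ring_nf
      have e2 : s ^ (2 * ρ - 1) = p ^ 2 := by
        rw [hp, ← Real.rpow_natCast, ← Real.rpow_mul h.le]
        push_cast
        ring_nf
      have e3 : s = w ^ 2 := by
        rw [hw, ← Real.rpow_natCast, ← Real.rpow_mul h.le]
        norm_num
      rw [e1, e2, le_div_iff₀ (by positivity)]
      nth_rewrite 1 [e3]
      nlinarith [sq_nonneg (N * p - 2 * b * v * w)]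
  rw [le_div_iff₀ hv]
  refine h1.trans ?_
  have : s ^ (2 * ρ - 1) ≤ δ ^ (2 * ρ - 1) :=
    Real.rpow_le_rpow hs.1 hs.2 (by linarith)
  gcongr

lemma mul_rpow_sub_le_of_le {N ρ b v s : ℝ} (hρ0 : 0 ≤ ρ) (hρ1 : ρ ≤ 1) (hN : 0 ≤ N)
    (hv : 0 < v) (hs : 0 ≤ s) (h : N * v ^ (1 - 2 * ρ) ≤ b) :
    N * s ^ ρ - b * v * s ≤ N * v ^ (1 - 2 * ρ) / v := by
  rw [le_div_iff₀ hv]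
  set p := v ^ 2 * s with hp
  have hp0 : 0 ≤ p := by positivity
  have e1 : N * s ^ ρ * v = N * v ^ (1 - 2 * ρ) * p ^ ρ := by
    rw [hp, Real.mul_rpow (by positivity) hs, ← Real.rpow_natCast, ← Real.rpow_mul hv.le,
      show N * v ^ (1 - 2 * ρ) * (v ^ (((2 : ℕ) : ℝ) * ρ) * s ^ ρ) =
        N * s ^ ρ * (v ^ (1 - 2 * ρ) * v ^ (((2 : ℕ) : ℝ) * ρ)) by ring, ← Real.rpow_add hv]
    push_cast
    rw [show 1 - 2 * ρ + 2 * ρ = 1 by ring, Real.rpow_one]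
  have h2 : p ^ ρ ≤ 1 + p := by
    rcases le_total p 1 with h' | h'
    · linarith [Real.rpow_le_one hp0 h' hρ0]
    · have := Real.rpow_le_rpow_of_exponent_le h' hρ1
      rw [Real.rpow_one] at this
      linarith
  have hq : 0 ≤ N * v ^ (1 - 2 * ρ) := by positivity
  calc (N * s ^ ρ - b * v * s) * v = N * v ^ (1 - 2 * ρ) * p ^ ρ - b * p := by
        rw [sub_mul, e1, hp]; ring
    _ ≤ N * v ^ (1 - 2 * ρ) * (1 + p) - N * v ^ (1 - 2 * ρ) * p := by gcongr
    _ = _ := by ring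

/-- Exponential moments, at a rate proportional to `v`, of the supremum of a path with Hölder
constant `N` minus a linear drift of slope `b * v`. -/
lemma tendsto_integral_exp_mul_of_drift [IsProbabilityMeasure P] {W : ℝ → Ω → ℝ} {N : Ω → ℝ}
    {ρ b δ η κ : ℝ} (hρ : 1 / 2 < ρ) (hρ1 : ρ ≤ 1) (hb : 0 < b)
    (hκ : 0 < κ) (hδη : κ * (δ ^ (2 * ρ - 1) / (4 * b)) ≤ η)
    (hN0 : ∀ ω, 0 ≤ N ω)
    (hNint : Integrable (fun ω => Real.exp (η * N ω ^ 2)) P)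
    (hWmeas : ∀ v, AEMeasurable (W v) P)
    (hW : ∀ᵐ ω ∂P, ∀ v > 0, 0 ≤ W v ω ∧
      ∀ B, (∀ s ∈ Icc 0 δ, N ω * s ^ ρ - b * v * s ≤ B) → W v ω ≤ B) :
    (∀ v > 0, Integrable (fun ω => Real.exp (κ * v * W v ω)) P) ∧
    Tendsto (fun v => ∫ ω, Real.exp (κ * v * W v ω) ∂P) atTop (nhds 1) := by
  have hmeas : ∀ v, AEStronglyMeasurable (fun ω => Real.exp (κ * v * W v ω)) P := fun v =>
    (Real.measurable_exp.comp_aemeasurable ((hWmeas v).const_mul _)).aestronglyMeasurable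
  have hbound : ∀ v > 0, ∀ᵐ ω ∂P, ‖Real.exp (κ * v * W v ω)‖ ≤ Real.exp (η * N ω ^ 2) := by
    intro v hv
    filter_upwards [hW] with ω hω
    rw [Real.norm_eq_abs, Real.abs_exp, Real.exp_le_exp]
    have h1 := (hω v hv).2 _ fun s hs => mul_rpow_sub_le_sq (N := N ω) hρ hb hv hs
    rw [le_div_iff₀ hv] at h1
    calc κ * v * W v ω = κ * (W v ω * v) := by ring
      _ ≤ κ * (N ω ^ 2 * δ ^ (2 * ρ - 1) / (4 * b)) := by gcongr
      _ = κ * (δ ^ (2 * ρ - 1) / (4 * b)) * N ω ^ 2 := by ring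
      _ ≤ η * N ω ^ 2 := by gcongr
  refine ⟨fun v hv => hNint.mono' (hmeas v) (hbound v hv), ?_⟩
  have hlim : Tendsto (fun v => ∫ ω, Real.exp (κ * v * W v ω) ∂P) atTop
      (nhds (∫ _, (1 : ℝ) ∂P)) := by
    refine tendsto_integral_filter_of_dominated_convergence _ (.of_forall hmeas)
      ((eventually_gt_atTop 0).mono hbound) hNint ?_
    filter_upwards [hW] with ω hω
    have hpow : Tendsto (fun v : ℝ => N ω * v ^ (1 - 2 * ρ)) atTop (nhds 0) := by
      have h := tendsto_rpow_neg_atTop (y := 2 * ρ - 1) (by linarith)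
      simp only [neg_sub] at h
      simpa using h.const_mul (N ω)
    have hvW : Tendsto (fun v : ℝ => v * W v ω) atTop (nhds 0) := by
      refine tendsto_of_tendsto_of_tendsto_of_le_of_le' tendsto_const_nhds hpow ?_ ?_
      · filter_upwards [eventually_gt_atTop 0] with v hv
        exact mul_nonneg hv.le (hω v hv).1
      · filter_upwards [eventually_gt_atTop 0, hpow.eventually (ge_mem_nhds hb)] with v hv hvb
        have h1 := (hω v hv).2 _ fun s hs =>
          mul_rpow_sub_le_of_le (by linarith) hρ1 (hN0 ω) hv hs.1 hvb
        rw [le_div_iff₀ hv] at h1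
        linarith
    have h2 := (Real.continuous_exp.tendsto _).comp (hvW.const_mul κ)
    simp only [mul_zero, Real.exp_zero] at h2
    refine h2.congr fun v => ?_
    simp [mul_assoc]
  simpa using hlim

/-- Adding an independent nonnegative perturbation to a centered normal variable multiplies
its tail by at most an exponential moment of the perturbation. -/
lemma measure_lt_add_le_of_indepFun [IsProbabilityMeasure P] {U W : Ω → ℝ} {σ v : ℝ}
    (hσ : 0 < σ) (hv : 1 ≤ v) (hU : Measurable U) (hWm : Measurable W)
    (hlaw : P.map U = gaussianReal 0 (σ ^ 2).toNNReal) (hind : IndepFun W U P)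
    (hW0 : ∀ᵐ ω ∂P, 0 ≤ W ω)
    (hint : Integrable (fun ω => Real.exp (10 * (1 / σ + 1) / σ * v * W ω)) P) :
    P {ω | v < U ω + 2 * W ω} ≤ ENNReal.ofReal
      (stdNormalTail (v / σ) * ∫ ω, Real.exp (10 * (1 / σ + 1) / σ * v * W ω) ∂P) := by
  have hne : (σ ^ 2).toNNReal ≠ 0 := by simp; positivity
  have hset : MeasurableSet {p : ℝ × ℝ | v < p.2 + 2 * p.1} :=
    measurableSet_lt (by fun_prop) (by fun_prop)
  have h1 : P {ω | v < U ω + 2 * W ω} =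
      ((P.map W).prod (P.map U)) {p : ℝ × ℝ | v < p.2 + 2 * p.1} := by
    rw [← (indepFun_iff_map_prod_eq_prod_map_map hWm.aemeasurable hU.aemeasurable).mp hind,
      Measure.map_apply (by fun_prop) hset]
    rfl
  have hprob : IsProbabilityMeasure (P.map U) := Measure.isProbabilityMeasure_map hU.aemeasurable
  rw [h1, Measure.prod_apply hset, lintegral_map (measurable_measure_prodMk_left hset) hWm,
    ← integral_const_mul, ofReal_integral_eq_lintegral_ofReal (hint.const_mul _)
      (.of_forall fun ω => mul_nonneg (stdNormalTail_nonneg _) (Real.exp_pos _).le)]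
  refine lintegral_mono_ae ?_
  filter_upwards [hW0] with ω hω
  have h2 : Prod.mk (W ω) ⁻¹' {p : ℝ × ℝ | v < p.2 + 2 * p.1} = Ioi (v - 2 * W ω) := by
    ext y
    simp [sub_lt_iff_lt_add]
  rw [h2, hlaw, gaussianReal_Ioi_eq_stdNormalTail hne]
  refine ENNReal.ofReal_le_ofReal ?_
  rw [Real.coe_toNNReal _ (by positivity), Real.sqrt_sq hσ.le, mul_comm (stdNormalTail _),
    sub_div]
  refine (stdNormalTail_sub_le (by positivity) (by positivity)).trans ?_
  refine mul_le_mul_of_nonneg_right (Real.exp_le_exp.mpr ?_) (stdNormalTail_nonneg _)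
  calc 5 * (v / σ + 1) * (2 * W ω / σ) = 10 * (v / σ + 1) / σ * W ω := by ring
    _ ≤ 10 * (v / σ + v) / σ * W ω := by gcongr
    _ = _ := by ring

end Asymptotics

section FarRange

variable {Ω : Type*} [MeasurableSpace Ω] {P : Measure Ω}

lemma measureReal_le_exp_of_map_eq_gaussianReal [IsProbabilityMeasure P] {U : Ω → ℝ}
    {v : NNReal} {s w : ℝ} (hU : Measurable U) (hlaw : P.map U = gaussianReal 0 v)
    (hs : 0 < s) (hv : v ≤ s) (hw : 0 ≤ w) :
    P.real {ω | w ≤ U ω} ≤ Real.exp (-(1 / s) * w ^ 2 / 2) := by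
  have hint : Integrable (fun ω => Real.exp (w / s * U ω)) P := by
    have h := integrable_exp_mul_gaussianReal (μ := 0) (v := v) (w / s)
    rw [← hlaw] at h
    exact h.comp_measurable hU
  refine (measure_ge_le_exp_mul_mgf w (t := w / s) (by positivity) hint).trans ?_
  rw [mgf_gaussianReal hlaw, ← Real.exp_add, Real.exp_le_exp]
  have h1 : (v : ℝ) * (w / s) ^ 2 / 2 ≤ s * (w / s) ^ 2 / 2 := by gcongr
  have h2 : s * (w / s) ^ 2 / 2 = 1 / s * w ^ 2 / 2 := by field_simp
  have h3 : -(w / s) * w = -(1 / s * w ^ 2) := by field_simp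
  linarith

/-- The supremum of a Gaussian path with a square-exponentially integrable Hölder constant has
a tail that is lighter than any Gaussian tail of larger variance. -/
lemma exists_measureReal_exists_lt_le [IsProbabilityMeasure P] {Y : ℝ → Ω → ℝ} {N : Ω → ℝ}
    {a ρ η s σ : ℝ} (hρ : 0 < ρ) (hη : 0 < η) (hs : 0 < s) (hσ : 0 < σ) (hsσ : s < σ ^ 2)
    (hN0 : ∀ ω, 0 ≤ N ω) (hNint : Integrable (fun ω => Real.exp (η * N ω ^ 2)) P)
    (hmeas : ∀ t ∈ Icc 0 a, Measurable (Y t))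
    (hlaw : ∀ t ∈ Icc 0 a, ∃ v : NNReal, P.map (Y t) = gaussianReal 0 v ∧ v ≤ s)
    (hY : ∀ᵐ ω ∂P, ∀ x ∈ Icc 0 a, ∀ t ∈ Icc 0 a, |Y t ω - Y x ω| ≤ N ω * |t - x| ^ ρ) :
    ∃ γ > 1 / σ ^ 2, ∃ C ≥ 0, ∀ w ≥ 0,
      P.real {ω | ∃ t ∈ Icc 0 a, w < Y t ω} ≤ C * Real.exp (-γ * w ^ 2 / 2) := by
  set q := √s / σ with hq
  have hq0 : 0 < q := by positivity
  have hq1 : q < 1 := by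
    rw [hq, div_lt_one hσ]
    exact (Real.sqrt_lt' hσ).mpr hsσ
  set ε := (1 - q) / 2 with hε
  have hε0 : 0 < ε := by linarith
  have hε1 : 0 < 1 - ε := by linarith
  have hqs : q ^ 2 * σ ^ 2 = s := by
    rw [hq, div_pow, Real.sq_sqrt hs.le]
    field_simp
  set h := (ε * σ * √η) ^ (1 / ρ) with hh
  have hh0 : 0 < h := by positivity
  have hhρ : h ^ ρ = ε * σ * √η := by
    rw [hh, ← Real.rpow_mul (by positivity), one_div_mul_cancel hρ.ne', Real.rpow_one]
  set γ := min ((1 - ε) ^ 2 / s) (2 / σ ^ 2) with hγ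
  set I := ∫ ω, Real.exp (η * N ω ^ 2) ∂P with hI
  set m := ⌊a / h⌋₊ with hm
  refine ⟨γ, lt_min ?_ ?_, (m + 1) + I, ?_, fun w hw => ?_⟩
  · rw [lt_div_iff₀ hs, div_mul_eq_mul_div, div_lt_iff₀ (by positivity), one_mul]
    calc s = q ^ 2 * σ ^ 2 := hqs.symm
      _ < (1 - ε) ^ 2 * σ ^ 2 := by
        have : q < 1 - ε := by linarith
        gcongr
  · gcongr
    norm_num
  · have : 0 ≤ I := integral_nonneg fun ω => (Real.exp_pos _).le
    positivity
  · set S : Finset ℕ := (Finset.range (m + 1)).filter fun j => (j : ℝ) * h ∈ Icc 0 a with hS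
    have hsub : P.real {ω | ∃ t ∈ Icc 0 a, w < Y t ω} ≤
        P.real ((⋃ j ∈ S, {ω | (1 - ε) * w ≤ Y (j * h) ω}) ∪
          {ω | Real.exp (w ^ 2 / σ ^ 2) ≤ Real.exp (η * N ω ^ 2)}) := by
      refine ENNReal.toReal_mono (measure_ne_top _ _) (measure_mono_ae ?_)
      filter_upwards [hY] with ω hω ht
      obtain ⟨t, ht, hwt⟩ := ht
      have hfl : (⌊t / h⌋₊ : ℝ) ≤ t / h := Nat.floor_le (div_nonneg ht.1 hh0.le)
      have hfl2 : t / h < ⌊t / h⌋₊ + 1 := Nat.lt_floor_add_one _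
      rw [le_div_iff₀ hh0] at hfl
      rw [div_lt_iff₀ hh0] at hfl2
      have hmem : (⌊t / h⌋₊ : ℝ) * h ∈ Icc 0 a := ⟨by positivity, hfl.trans ht.2⟩
      by_cases hc : (1 - ε) * w ≤ Y (⌊t / h⌋₊ * h) ω
      · refine Or.inl (mem_iUnion₂.mpr ⟨⌊t / h⌋₊, ?_, hc⟩)
        rw [hS, Finset.mem_filter, Finset.mem_range]
        refine ⟨Nat.lt_succ_of_le (Nat.floor_le_floor ?_), hmem⟩
        have := ht.2
        gcongr
      · refine Or.inr ?_
        push Not at hc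
        have h1 := (le_abs_self _).trans (hω _ hmem t ht)
        have h2 : |t - ⌊t / h⌋₊ * h| ^ ρ ≤ h ^ ρ := by
          refine Real.rpow_le_rpow (abs_nonneg _) ?_ hρ.le
          rw [abs_of_nonneg (by linarith)]
          linarith
        have h3 : ε * w ≤ ε * (N ω * σ * √η) := by
          have := mul_le_mul_of_nonneg_left h2 (hN0 ω)
          rw [hhρ] at this
          linarith
        have h4 := le_of_mul_le_mul_left h3 hε0
        have h5 : w ^ 2 ≤ η * N ω ^ 2 * σ ^ 2 := by
          calc w ^ 2 ≤ (N ω * σ * √η) ^ 2 := by gcongr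
            _ = √η ^ 2 * N ω ^ 2 * σ ^ 2 := by ring
            _ = _ := by rw [Real.sq_sqrt hη.le]
        change Real.exp _ ≤ Real.exp _
        rw [Real.exp_le_exp, div_le_iff₀ (by positivity)]
        exact h5
    have hgrid : P.real (⋃ j ∈ S, {ω | (1 - ε) * w ≤ Y (j * h) ω}) ≤
        (m + 1) * Real.exp (-γ * w ^ 2 / 2) := by
      refine (measureReal_biUnion_finset_le _ _).trans ?_
      have : ∀ j ∈ S, P.real {ω | (1 - ε) * w ≤ Y (j * h) ω} ≤ Real.exp (-γ * w ^ 2 / 2) := by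
        intro j hj
        obtain ⟨v, hv, hvs⟩ := hlaw _ (Finset.mem_filter.mp hj).2
        refine (measureReal_le_exp_of_map_eq_gaussianReal (hmeas _ (Finset.mem_filter.mp hj).2)
          hv hs hvs (by positivity)).trans (Real.exp_le_exp.mpr ?_)
        have h1 : γ * w ^ 2 ≤ (1 - ε) ^ 2 / s * w ^ 2 := by
          gcongr
          exact min_le_left _ _
        have h2 : 1 / s * ((1 - ε) * w) ^ 2 = (1 - ε) ^ 2 / s * w ^ 2 := by ring
        linarith
      refine (Finset.sum_le_card_nsmul _ _ _ this).trans ?_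
      rw [nsmul_eq_mul]
      gcongr
      have : S.card ≤ m + 1 := (Finset.card_filter_le _ _).trans (Finset.card_range _).le
      exact_mod_cast this
    have hosc : P.real {ω | Real.exp (w ^ 2 / σ ^ 2) ≤ Real.exp (η * N ω ^ 2)} ≤
        I * Real.exp (-γ * w ^ 2 / 2) := by
      have h1 := mul_meas_ge_le_integral_of_nonneg (μ := P)
        (.of_forall fun ω => (Real.exp_pos (η * N ω ^ 2)).le) hNint (Real.exp (w ^ 2 / σ ^ 2))
      have h2 : γ * w ^ 2 ≤ 2 / σ ^ 2 * w ^ 2 := by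
        gcongr
        exact min_le_right _ _
      rw [← le_div_iff₀' (Real.exp_pos _), div_eq_mul_inv (∫ ω, _ ∂P), ← Real.exp_neg] at h1
      refine h1.trans ?_
      gcongr
      have : 2 / σ ^ 2 * w ^ 2 = 2 * (w ^ 2 / σ ^ 2) := by ring
      linarith
    calc _ ≤ _ := hsub
      _ ≤ _ := measureReal_union_le _ _
      _ ≤ _ := add_le_add hgrid hosc
      _ = _ := by ring

/-- On a range where the variance stays below `σ ^ 2`, exceedances of a high level are negligible
with respect to the Gaussian tail of variance `σ ^ 2`. -/
lemma tendsto_measureReal_exists_lt_div_stdNormalTail [IsProbabilityMeasure P] {Y : ℝ → Ω → ℝ}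
    {N : Ω → ℝ} {a ρ η s σ : ℝ} (B : ℝ) (hρ : 0 < ρ) (hη : 0 < η) (hs : 0 < s) (hσ : 0 < σ)
    (hsσ : s < σ ^ 2) (hN0 : ∀ ω, 0 ≤ N ω)
    (hNint : Integrable (fun ω => Real.exp (η * N ω ^ 2)) P)
    (hmeas : ∀ t ∈ Icc 0 a, Measurable (Y t))
    (hlaw : ∀ t ∈ Icc 0 a, ∃ v : NNReal, P.map (Y t) = gaussianReal 0 v ∧ v ≤ s)
    (hY : ∀ᵐ ω ∂P, ∀ x ∈ Icc 0 a, ∀ t ∈ Icc 0 a, |Y t ω - Y x ω| ≤ N ω * |t - x| ^ ρ) :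
    Tendsto (fun v => P.real {ω | ∃ t ∈ Icc 0 a, v - B < Y t ω} / stdNormalTail (v / σ))
      atTop (nhds 0) := by
  obtain ⟨γ, hγ, C, hC, hbound⟩ :=
    exists_measureReal_exists_lt_le hρ hη hs hσ hsσ hN0 hNint hmeas hlaw hY
  set D := C * (5 * √(2 * Real.pi)) with hD
  have hlim : Tendsto (fun v : ℝ => D * (1 / σ * (v ^ (1 : ℝ) * Real.exp (-1 * v)) +
      Real.exp (-v))) atTop (nhds 0) := by
    have h1 := tendsto_rpow_mul_exp_neg_mul_atTop_nhds_zero 1 1 one_pos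
    have h2 : Tendsto (fun v : ℝ => Real.exp (-v)) atTop (nhds 0) :=
      Real.tendsto_exp_neg_atTop_nhds_zero
    simpa using ((h1.const_mul (1 / σ)).add h2).const_mul D
  have hexp : ∀ᶠ v : ℝ in atTop, v ^ 2 / σ ^ 2 / 2 - γ * (v - B) ^ 2 / 2 ≤ -v := by
    set θ := γ - 1 / σ ^ 2 with hθ
    have hθ0 : 0 < θ := by linarith
    have hγ0 : 0 < γ := lt_trans (by positivity) hγ
    filter_upwards [eventually_ge_atTop (2 * (1 + γ * |B|) / θ), eventually_ge_atTop 0]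
      with v hv hv0
    rw [div_le_iff₀ hθ0] at hv
    have h1 : v ^ 2 / σ ^ 2 = (γ - θ) * v ^ 2 := by rw [hθ]; ring
    have h2 : γ * v * B ≤ γ * v * |B| := by
      gcongr
      exact le_abs_self B
    have h3 : 2 * (1 + γ * |B|) * v ≤ v * θ * v := by gcongr
    have h4 : 0 ≤ γ * B ^ 2 := by positivity
    rw [h1]
    nlinarith
  refine tendsto_of_tendsto_of_tendsto_of_le_of_le' tendsto_const_nhds hlim
    (.of_forall fun v => div_nonneg measureReal_nonneg (stdNormalTail_nonneg _)) ?_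
  filter_upwards [hexp, eventually_ge_atTop 0, eventually_ge_atTop B] with v hv hv0 hvB
  have hvσ : 0 ≤ v / σ := by positivity
  have hpos := stdNormalTail_pos_of_nonneg hvσ
  rw [div_le_iff₀ hpos]
  have h1 := exp_le_mul_stdNormalTail hvσ
  calc _ ≤ _ := hbound (v - B) (by linarith)
    _ = C * Real.exp (v ^ 2 / σ ^ 2 / 2 - γ * (v - B) ^ 2 / 2) *
        Real.exp (-(v / σ) ^ 2 / 2) := by
      rw [mul_assoc, ← Real.exp_add]
      congr 2
      ring
    _ ≤ C * Real.exp (-v) * (5 * √(2 * Real.pi) * (v / σ + 1) * stdNormalTail (v / σ)) := by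
      gcongr
    _ = _ := by
      rw [hD, Real.rpow_one]
      ring_nf

end FarRange

section GaussianProcess

variable {Ω : Type*} [MeasurableSpace Ω] {P : Measure Ω}

lemma integral_sq_of_map_eq_gaussianReal {U : Ω → ℝ} {v : NNReal} (hU : Measurable U)
    (hlaw : P.map U = gaussianReal 0 v) : ∫ ω, U ω ^ 2 ∂P = v := by
  have h1 : ∫ ω, U ω ^ 2 ∂P = ∫ x, x ^ 2 ∂(P.map U) :=
    (integral_map hU.aemeasurable (f := fun x : ℝ => x ^ 2) (by fun_prop)).symm
  have h2 := variance_id_gaussianReal (μ := 0) (v := v)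
  rw [variance_eq_integral measurable_id.aemeasurable] at h2
  rw [h1, hlaw, ← h2]
  simp

lemma integral_of_map_eq_gaussianReal {U : Ω → ℝ} {v : NNReal} (hU : Measurable U)
    (hlaw : P.map U = gaussianReal 0 v) : ∫ ω, U ω ∂P = 0 := by
  have h1 : ∫ ω, U ω ∂P = ∫ x, x ∂(P.map U) :=
    (integral_map hU.aemeasurable (f := fun x : ℝ => x) (by fun_prop)).symm
  rw [h1, hlaw, integral_id_gaussianReal]

lemma memLp_two_of_map_eq_gaussianReal {U : Ω → ℝ} {v : NNReal}
    (hlaw : P.map U = gaussianReal 0 v) : MemLp U 2 P := by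
  have : HasGaussianLaw U P := ⟨by rw [hlaw]; infer_instance⟩
  exact this.memLp_two

namespace IsCenteredGaussianProcess

variable {T : ℝ} {Y : ℝ → Ω → ℝ}

lemma exists_map_linearCombination (hY : IsCenteredGaussianProcess P T Y) (a b c : ℝ) {s t u : ℝ}
    (hs : s ∈ Icc 0 T) (ht : t ∈ Icc 0 T) (hu : u ∈ Icc 0 T) :
    ∃ v : NNReal, P.map (fun ω => a * Y s ω + b * Y t ω + c * Y u ω) = gaussianReal 0 v := by
  obtain ⟨v, hv⟩ := hY.2 3 ![a, b, c] ![s, t, u] (by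
    intro j
    fin_cases j <;> assumption)
  refine ⟨v, ?_⟩
  simpa [Fin.sum_univ_three] using hv

lemma exists_map_eq (hY : IsCenteredGaussianProcess P T Y) {t : ℝ} (ht : t ∈ Icc 0 T) :
    ∃ v : NNReal, P.map (Y t) = gaussianReal 0 v := by
  obtain ⟨v, hv⟩ := hY.exists_map_linearCombination 1 0 0 ht ht ht
  exact ⟨v, by simpa using hv⟩

lemma exists_map_sub_eq (hY : IsCenteredGaussianProcess P T Y) {s t : ℝ} (hs : s ∈ Icc 0 T)
    (ht : t ∈ Icc 0 T) :
    ∃ v : NNReal, P.map (fun ω => Y t ω - Y s ω) = gaussianReal 0 v ∧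
      v = ∫ ω, (Y t ω - Y s ω) ^ 2 ∂P := by
  obtain ⟨v, hv⟩ := hY.exists_map_linearCombination (-1) 1 0 hs ht ht
  have hv' : P.map (fun ω => Y t ω - Y s ω) = gaussianReal 0 v := by
    convert hv using 3
    ring
  exact ⟨v, hv', (integral_sq_of_map_eq_gaussianReal ((hY.1 t ht).sub (hY.1 s hs)) hv').symm⟩

lemma memLp_two (hY : IsCenteredGaussianProcess P T Y) {t : ℝ} (ht : t ∈ Icc 0 T) :
    MemLp (Y t) 2 P :=
  memLp_two_of_map_eq_gaussianReal (hY.exists_map_eq ht).choose_spec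

lemma integral_eq_zero (hY : IsCenteredGaussianProcess P T Y) {t : ℝ} (ht : t ∈ Icc 0 T) :
    ∫ ω, Y t ω ∂P = 0 :=
  integral_of_map_eq_gaussianReal (hY.1 t ht) (hY.exists_map_eq ht).choose_spec

lemma isGaussianProcess (hY : IsCenteredGaussianProcess P T Y) :
    IsGaussianProcess (fun t : Icc (0 : ℝ) T => Y t) P where
  hasGaussianLaw I := by
    have hmeas : Measurable fun ω => I.restrict fun t : Icc (0 : ℝ) T => Y t ω :=
      measurable_pi_lambda _ fun t => hY.1 _ t.1.2
    refine ⟨⟨fun L => ?_⟩⟩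
    have hL : ∀ x, L x = ∑ i, L (Pi.single i 1) * x i := fun x => by
      conv_lhs => rw [← Finset.univ_sum_single x, map_sum]
      refine Finset.sum_congr rfl fun i _ => ?_
      rw [show (Pi.single i (x i) : I → ℝ) = x i • Pi.single i 1 by
        rw [← Pi.single_smul, smul_eq_mul, mul_one], map_smul, smul_eq_mul, mul_comm]
    have hlaw : HasGaussianLaw (fun ω => L (I.restrict fun t : Icc (0 : ℝ) T => Y t ω)) P := by
      obtain ⟨v, hv⟩ := hY.2 I.card (fun j => L (Pi.single (I.equivFin.symm j) 1))
        (fun j => (I.equivFin.symm j : Icc (0 : ℝ) T)) fun j => (I.equivFin.symm j).1.2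
      refine ⟨?_⟩
      have : (fun ω => L (I.restrict fun t : Icc (0 : ℝ) T => Y t ω)) =
          fun ω => ∑ j, L (Pi.single (I.equivFin.symm j) 1) * Y (I.equivFin.symm j).1 ω := by
        funext ω
        rw [hL, ← I.equivFin.symm.sum_comp]
        rfl
      rw [this, hv]
      infer_instance
    rw [Measure.map_map L.continuous.measurable hmeas, integral_map hmeas.aemeasurable
      L.continuous.aestronglyMeasurable, variance_map L.continuous.aemeasurable hmeas.aemeasurable]
    exact hlaw.map_eq_gaussianReal

/-- The residual of the regression of a centered Gaussian process on one of its values is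
independent of that value. -/
lemma indepFun_residual (hY : IsCenteredGaussianProcess P T Y) (hT : T ∈ Icc 0 T) {r : ℝ → ℝ}
    (hr : ∀ t ∈ Icc 0 T, ∫ ω, Y t ω * Y T ω ∂P = r t * ∫ ω, Y T ω ^ 2 ∂P) :
    IndepFun (fun ω (t : Icc (0 : ℝ) T) => Y t ω - r t * Y T ω) (fun ω (_ : Unit) => Y T ω) P := by
  classical
  have hprob := hY.isGaussianProcess.isProbabilityMeasure
  have hmeas := hY.1
  have hZ : ∀ t : Icc (0 : ℝ) T, Measurable fun ω => Y t ω - r t * Y T ω := fun t =>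
    (hmeas t t.2).sub ((hmeas T hT).const_mul _)
  refine IsGaussianProcess.indepFun_of_covariance_eq_zero
    (X := fun (t : Icc (0 : ℝ) T) ω => Y t ω - r t * Y T ω) (Y := fun (_ : Unit) => Y T) ?_
    (fun t => (hZ t).aemeasurable) (fun _ => (hmeas T hT).aemeasurable) fun t _ => ?_
  · refine hY.isGaussianProcess.of_isGaussianProcess fun s => ?_
    rcases s with t | _
    · refine ⟨{t, ⟨T, hT⟩}, .proj ⟨t, by simp⟩ - r t • .proj ⟨⟨T, hT⟩, by simp⟩, fun ω => ?_⟩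
      simp
    · exact ⟨{⟨T, hT⟩}, .proj ⟨⟨T, hT⟩, by simp⟩, fun ω => by simp⟩
  · have h2 := hY.memLp_two hT
    have h1 := hY.memLp_two t.2
    have h3 : MemLp (fun ω => Y t ω - r t * Y T ω) 2 P := h1.sub (h2.const_mul _)
    rw [covariance_eq_sub h3 h2, hY.integral_eq_zero hT, mul_zero, sub_zero]
    have : ∀ ω, (Y t ω - r t * Y T ω) * Y T ω = Y t ω * Y T ω - r t * Y T ω ^ 2 := fun ω => by
      ring
    simp only [Pi.mul_apply, this]
    have h4 : Integrable (fun ω => Y t ω * Y T ω) P := h1.integrable_mul h2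
    rw [integral_sub h4 (h2.integrable_sq.const_mul _), integral_const_mul,
      hr t t.2, sub_self]

lemma integral_residual_sub_sq (hY : IsCenteredGaussianProcess P T Y) (hT : T ∈ Icc 0 T)
    {r : ℝ → ℝ} (hr : ∀ t ∈ Icc 0 T, ∫ ω, Y t ω * Y T ω ∂P = r t * ∫ ω, Y T ω ^ 2 ∂P) {s t : ℝ}
    (hs : s ∈ Icc 0 T) (ht : t ∈ Icc 0 T) :
    ∫ ω, (Y t ω - r t * Y T ω - (Y s ω - r s * Y T ω)) ^ 2 ∂P =
      ∫ ω, (Y t ω - Y s ω) ^ 2 ∂P - (r t - r s) ^ 2 * ∫ ω, Y T ω ^ 2 ∂P := by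
  have h1 := hY.memLp_two ht
  have h2 := hY.memLp_two hs
  have h3 := hY.memLp_two hT
  have e : ∀ ω, (Y t ω - r t * Y T ω - (Y s ω - r s * Y T ω)) ^ 2 = (Y t ω - Y s ω) ^ 2 -
      2 * (r t - r s) * (Y t ω * Y T ω - Y s ω * Y T ω) + (r t - r s) ^ 2 * Y T ω ^ 2 :=
    fun ω => by ring
  simp only [e]
  have i1 : Integrable (fun ω => (Y t ω - Y s ω) ^ 2) P := (h1.sub h2).integrable_sq
  have i2 : Integrable (fun ω => Y t ω * Y T ω - Y s ω * Y T ω) P :=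
    (h1.integrable_mul h3).sub (h2.integrable_mul h3)
  have i3 : Integrable (fun ω => (Y t ω - Y s ω) ^ 2 -
      2 * (r t - r s) * (Y t ω * Y T ω - Y s ω * Y T ω)) P := i1.sub (i2.const_mul _)
  have i4 : Integrable (fun ω => Y t ω * Y T ω) P := h1.integrable_mul h3
  have i5 : Integrable (fun ω => Y s ω * Y T ω) P := h2.integrable_mul h3
  rw [integral_add i3 (h3.integrable_sq.const_mul _), integral_sub i1 (i2.const_mul _),
    integral_const_mul, integral_const_mul,
    integral_sub i4 i5, hr t ht, hr s hs]
  ring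

end IsCenteredGaussianProcess

end GaussianProcess

section NearEndpoint

variable {Ω : Type*} [MeasurableSpace Ω] {P : Measure Ω}

/-- On a short enough final interval, exceedances of a high level `v` are asymptotically no more
likely than exceedances at the endpoint. -/
lemma exists_measureReal_exists_lt_le_stdNormalTail_mul [IsProbabilityMeasure P]
    {Y : ℝ → Ω → ℝ} {T α C c σ M ν : ℝ} {g : ℝ → ℝ} (hY : IsCenteredGaussianProcess P T Y)
    (hcont : ∀ᵐ ω ∂P, ContinuousOn (fun t => Y t ω) (Icc 0 T))
    (hα : 1 < α) (hα2 : α ≤ 2) (hC : 0 < C) (hσ : 0 < σ) (hc : 0 < c)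
    (hinc : ∀ s ∈ Icc 0 T, ∀ t ∈ Icc 0 T, ∫ ω, (Y t ω - Y s ω) ^ 2 ∂P ≤ C * |t - s| ^ α)
    (hvarT : ∫ ω, Y T ω ^ 2 ∂P = σ ^ 2)
    (hcov : ∀ t ∈ Icc 0 T, ∫ ω, Y t ω * Y T ω ∂P ≤ σ ^ 2 - c * (T - t))
    (hν : ν ∈ Ioo 0 T) (hg : ∀ t ∈ Icc ν T, |g T - g t| ≤ M * (T - t)) :
    ∃ δ, 0 < δ ∧ δ < T ∧ ∃ R : ℝ → ℝ, Tendsto R atTop (nhds 1) ∧ ∀ᶠ v in atTop,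
      P.real {ω | ∃ t ∈ Icc (T - δ) T, v - (g T - g t) < Y t ω} ≤
        stdNormalTail (v / σ) * R v := by
  have hT : 0 < T := hν.1.trans hν.2
  have hTm : T ∈ Icc 0 T := ⟨hT.le, le_rfl⟩
  set r : ℝ → ℝ := fun t => (∫ ω, Y t ω * Y T ω ∂P) / σ ^ 2 with hr
  have hrY : ∀ t ∈ Icc 0 T, ∫ ω, Y t ω * Y T ω ∂P = r t * ∫ ω, Y T ω ^ 2 ∂P := fun t _ => by
    rw [hvarT, hr]
    field_simp
  have hrT : r T = 1 := by
    have : ∫ ω, Y T ω * Y T ω ∂P = σ ^ 2 := by simpa only [sq] using hvarT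
    simp only [hr, this]
    field_simp
  set c' := c / σ ^ 2 with hc'
  have hc'0 : 0 < c' := by positivity
  have hr1 : ∀ t ∈ Icc 0 T, c' * (T - t) ≤ 1 - r t := by
    intro t ht
    have h1 : r t ≤ (σ ^ 2 - c * (T - t)) / σ ^ 2 := by
      simp only [hr]
      gcongr
      exact hcov t ht
    have h2 : (σ ^ 2 - c * (T - t)) / σ ^ 2 = 1 - c' * (T - t) := by
      rw [hc']
      field_simp
    linarith
  set Z : ℝ → Ω → ℝ := fun t ω => Y t ω - r t * Y T ω with hZ
  have hZT : ∀ ω, Z T ω = 0 := fun ω => by simp [hZ, hrT]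
  have hZmeas : ∀ t ∈ Icc 0 T, Measurable (Z t) := fun t ht =>
    (hY.1 t ht).sub ((hY.1 T hTm).const_mul _)
  have hZinc : ∀ s ∈ Icc 0 T, ∀ t ∈ Icc 0 T,
      ∫ ω, (Z t ω - Z s ω) ^ 2 ∂P = ∫ ω, (Y t ω - Y s ω) ^ 2 ∂P - (r t - r s) ^ 2 * σ ^ 2 := by
    intro s hs t ht
    rw [← hvarT]
    exact hY.integral_residual_sub_sq hTm hrY hs ht
  have hrinc : ∀ s ∈ Icc 0 T, ∀ t ∈ Icc 0 T, (r t - r s) ^ 2 ≤ C / σ ^ 2 * |t - s| ^ α := by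
    intro s hs t ht
    have h1 : 0 ≤ ∫ ω, (Z t ω - Z s ω) ^ 2 ∂P := integral_nonneg fun ω => sq_nonneg _
    rw [hZinc s hs t ht] at h1
    rw [div_mul_eq_mul_div, le_div_iff₀ (by positivity)]
    linarith [hinc s hs t ht]
  have hrcont : ContinuousOn r (Icc 0 T) := by
    intro s hs
    rw [ContinuousWithinAt, tendsto_iff_dist_tendsto_zero]
    have h1 : Tendsto (fun t => √(C / σ ^ 2 * |t - s| ^ α)) (nhdsWithin s (Icc 0 T)) (nhds 0) := by
      have h2 : Continuous fun t => √(C / σ ^ 2 * |t - s| ^ α) := by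
        refine Real.continuous_sqrt.comp (continuous_const.mul ?_)
        exact (continuous_abs.comp (continuous_id.sub continuous_const)).rpow_const
          fun _ => Or.inr (by linarith)
      have h3 := (h2.tendsto s).mono_left (nhdsWithin_le_nhds (s := Icc 0 T))
      simpa [Real.zero_rpow (by linarith : α ≠ 0)] using h3
    refine squeeze_zero' (.of_forall fun t => dist_nonneg) ?_ h1
    filter_upwards [self_mem_nhdsWithin] with t ht
    rw [Real.dist_eq]
    exact Real.abs_le_sqrt (hrinc s hs t ht)
  obtain ⟨N, hNm, hN0, ⟨η, hη, hNint⟩, hN⟩ := exists_holder_exp_integrable (P := P) (Y := Z)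
    (ρ := (1 + α) / 4) (α := α) (C := C) hT (by linarith) (by linarith) hC hZmeas
    (by
      intro s hs t ht
      obtain ⟨w, hw⟩ := hY.exists_map_linearCombination (-1) 1 (-(r t - r s)) hs ht hTm
      have hw' : P.map (fun ω => Z t ω - Z s ω) = gaussianReal 0 w := by
        rw [← hw]
        congr 1
        funext ω
        simp only [hZ]
        ring
      refine ⟨w, hw', ?_⟩
      rw [← integral_sq_of_map_eq_gaussianReal (U := fun ω => Z t ω - Z s ω)
        ((hZmeas t ht).sub (hZmeas s hs)) hw',
        hZinc s hs t ht]
      have : 0 ≤ (r t - r s) ^ 2 * σ ^ 2 := by positivity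
      linarith [hinc s hs t ht])
    (by
      filter_upwards [hcont] with ω hω
      exact hω.sub (hrcont.mul continuousOn_const))
  set ρ := (1 + α) / 4 with hρ
  have hρ0 : 1 / 2 < ρ := by rw [hρ]; linarith
  have hρ1 : ρ ≤ 1 := by rw [hρ]; linarith
  set κ := 10 * (1 / σ + 1) / σ with hκ
  have hκ0 : 0 < κ := by positivity
  set b := c' / 2 with hb
  have hb0 : 0 < b := by positivity
  obtain ⟨δ, hδ0, hδT, hδν, hδη, hδr⟩ : ∃ δ, 0 < δ ∧ δ < T ∧ δ ≤ T - ν ∧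
      κ * (δ ^ (2 * ρ - 1) / (4 * b)) ≤ η ∧ ∀ t ∈ Icc (T - δ) T, 1 / 2 ≤ r t := by
    have h1 : ∀ᶠ δ : ℝ in nhdsWithin 0 (Ioi 0), κ * (δ ^ (2 * ρ - 1) / (4 * b)) < η := by
      have h2 : Continuous fun δ : ℝ => κ * (δ ^ (2 * ρ - 1) / (4 * b)) :=
        continuous_const.mul ((continuous_id.rpow_const
          fun _ => Or.inr (by linarith)).div_const _)
      have h3 := (h2.tendsto 0).mono_left (nhdsWithin_le_nhds (s := Ioi 0))
      rw [Real.zero_rpow (by linarith), zero_div, mul_zero] at h3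
      exact h3.eventually_lt_const hη
    obtain ⟨θ, hθ, hθr⟩ := Metric.continuousOn_iff.mp hrcont T hTm (1 / 2) (by norm_num)
    have h2 : ∀ᶠ δ : ℝ in nhdsWithin 0 (Ioi 0), δ < min (min T (T - ν)) θ := by
      refine nhdsWithin_le_nhds (Iio_mem_nhds ?_)
      exact lt_min (lt_min hT (by linarith [hν.2])) hθ
    obtain ⟨δ, ⟨hδ1, hδ2⟩, hδ0⟩ := ((h1.and h2).and self_mem_nhdsWithin).exists
    rw [lt_min_iff, lt_min_iff] at hδ2
    refine ⟨δ, hδ0, hδ2.1.1, hδ2.1.2.le, hδ1.le, fun t ht => ?_⟩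
    have h3 := hθr t ⟨by linarith [ht.1, hδ2.1.1], ht.2⟩ (by
      rw [Real.dist_eq, abs_sub_comm, abs_of_nonneg (by linarith [ht.2])]
      linarith [ht.1, hδ2.2])
    rw [Real.dist_eq, hrT, abs_lt] at h3
    linarith
  have hsub : Icc (T - δ) T ⊆ Icc 0 T := Icc_subset_Icc_left (by linarith)
  have hTδ : T ∈ Icc (T - δ) T := ⟨by linarith, le_rfl⟩
  have : Nonempty (Icc (T - δ) T) := ⟨⟨T, hTδ⟩⟩
  set d := TopologicalSpace.denseSeq (Icc (T - δ) T) with hd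
  have hdd : DenseRange d := TopologicalSpace.denseRange_denseSeq _
  set W : ℝ → Ω → ℝ := fun v ω => ⨆ n, (Z (d n) ω - b * v * (T - d n)) with hW
  have hWmeas : ∀ v, Measurable (W v) := fun v =>
    Measurable.iSup fun n => (hZmeas _ (hsub (d n).2)).sub measurable_const
  have hZN : ∀ᵐ ω ∂P, ∀ t ∈ Icc (T - δ) T, Z t ω ≤ N ω * (T - t) ^ ρ := by
    filter_upwards [hN] with ω hω t ht
    have h1 := (le_abs_self _).trans (hω T hTm t (hsub ht))
    rwa [hZT, sub_zero, abs_sub_comm, abs_of_nonneg (by linarith [ht.2])] at h1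
  have hWbdd : ∀ᵐ ω ∂P, ∀ v > 0, BddAbove (range fun n => Z (d n) ω - b * v * (T - d n)) := by
    filter_upwards [hZN] with ω hω v hv
    refine ⟨N ω * δ ^ ρ, ?_⟩
    rintro _ ⟨n, rfl⟩
    have h1 := hω _ (d n).2
    have h2 : 0 ≤ b * v * (T - d n) := mul_nonneg (by positivity) (by linarith [(d n).2.2])
    have h3 : (T - d n) ^ ρ ≤ δ ^ ρ :=
      Real.rpow_le_rpow (by linarith [(d n).2.2]) (by linarith [(d n).2.1]) (by linarith)
    have h4 := mul_le_mul_of_nonneg_left h3 (hN0 ω)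
    change Z (d n) ω - _ ≤ _
    linarith
  have hWge : ∀ᵐ ω ∂P, ∀ v > 0, ∀ t ∈ Icc (T - δ) T, Z t ω - b * v * (T - t) ≤ W v ω := by
    filter_upwards [hcont, hWbdd] with ω hω hbdd v hv t ht
    refine le_ciSup_of_denseRange hdd (f := fun t => Z t ω - b * v * (T - t)) ?_ (hbdd v hv) ht
    refine ContinuousOn.sub ?_ (by fun_prop)
    exact (hω.sub (hrcont.mul continuousOn_const)).mono hsub
  have hW0 : ∀ᵐ ω ∂P, ∀ v > 0, 0 ≤ W v ω := by
    filter_upwards [hWge] with ω hω v hv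
    simpa [hZT] using hω v hv T hTδ
  obtain ⟨hint, hlim⟩ := tendsto_integral_exp_mul_of_drift (P := P) (W := W) (N := N) (δ := δ)
    hρ0 hρ1 hb0 hκ0 hδη hN0 hNint (fun v => (hWmeas v).aemeasurable) (by
      filter_upwards [hW0, hZN] with ω h0 hω v hv
      refine ⟨h0 v hv, fun B hB => ciSup_le fun n => ?_⟩
      exact (sub_le_sub_right (hω _ (d n).2) _).trans
        (hB (T - d n) ⟨by linarith [(d n).2.2], by linarith [(d n).2.1]⟩))
  have hind : ∀ v, IndepFun (W v) (Y T) P := by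
    intro v
    have h1 := hY.indepFun_residual hTm hrY
    have h2 : Measurable fun x : Icc (0 : ℝ) T → ℝ =>
        ⨆ n, (x ⟨d n, hsub (d n).2⟩ - b * v * (T - d n)) :=
      Measurable.iSup fun n => (measurable_pi_apply _).sub measurable_const
    exact h1.comp h2 (measurable_pi_apply ())
  have hlaw : P.map (Y T) = gaussianReal 0 (σ ^ 2).toNNReal := by
    obtain ⟨w, hw⟩ := hY.exists_map_eq hTm
    rw [hw, ← hvarT, integral_sq_of_map_eq_gaussianReal (hY.1 T hTm) hw, Real.toNNReal_coe]
  refine ⟨δ, hδ0, hδT, fun v => ∫ ω, Real.exp (κ * v * W v ω) ∂P, hlim, ?_⟩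
  filter_upwards [eventually_ge_atTop 1, eventually_ge_atTop (M / b)] with v hv1 hvM
  have hv0 : 0 < v := by linarith
  rw [div_le_iff₀ hb0] at hvM
  have hnear : P {ω | ∃ t ∈ Icc (T - δ) T, v - (g T - g t) < Y t ω} ≤
      P {ω | v < Y T ω + 2 * W v ω} := by
    refine measure_mono_ae ?_
    filter_upwards [hWge, hW0] with ω hge h0 ht
    obtain ⟨t, ht, hlt⟩ := ht
    change v < Y T ω + 2 * W v ω
    rcases lt_or_ge v (Y T ω) with h | h
    · linarith [h0 v hv0]
    · have h1 := hge v hv0 t ht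
      have h2 := (le_abs_self _).trans (hg t ⟨by linarith [ht.1], ht.2⟩)
      have h3 := mul_le_mul_of_nonneg_right (hδr t ht) (sub_nonneg.mpr h)
      have h4 := mul_le_mul_of_nonneg_right (hr1 t (hsub ht)) hv0.le
      have h5 : M * (T - t) ≤ v * b * (T - t) :=
        mul_le_mul_of_nonneg_right hvM (by linarith [ht.2])
      have h6 : c' = 2 * b := by rw [hb]; ring
      have h7 : Z t ω = Y t ω - r t * Y T ω := rfl
      rw [h6] at h4
      nlinarith
  have h := measure_lt_add_le_of_indepFun hσ hv1 (hY.1 T hTm) (hWmeas v) hlaw (hind v)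
    (hW0.mono fun ω hω => hω v hv0) (hint v hv0)
  have hpos : 0 ≤ stdNormalTail (v / σ) * ∫ ω, Real.exp (κ * v * W v ω) ∂P :=
    mul_nonneg (stdNormalTail_nonneg _) (integral_nonneg fun ω => (Real.exp_pos _).le)
  exact ENNReal.toReal_le_of_le_ofReal hpos (hnear.trans h)

end NearEndpoint

section ExactAsymptotics

variable {Ω : Type*} [MeasurableSpace Ω] {P : Measure Ω}

/-- A centered Gaussian process with increments of order above `1 / 2`, whose variance has a
unique maximum at `T` with a linear decay, has the same tail as its value at `T`, up to a drift. -/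
theorem tendsto_measure_lt_iSup_div_stdNormalTail [IsProbabilityMeasure P]
    {Y : ℝ → Ω → ℝ} {T α C c σ B M ν : ℝ} {g : ℝ → ℝ} (hY : IsCenteredGaussianProcess P T Y)
    (hcont : ∀ᵐ ω ∂P, ContinuousOn (fun t => Y t ω) (Icc 0 T))
    (hα : 1 < α) (hα2 : α ≤ 2) (hC : 0 < C) (hσ : 0 < σ) (hc : 0 < c)
    (hinc : ∀ s ∈ Icc 0 T, ∀ t ∈ Icc 0 T, ∫ ω, (Y t ω - Y s ω) ^ 2 ∂P ≤ C * |t - s| ^ α)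
    (hvarT : ∫ ω, Y T ω ^ 2 ∂P = σ ^ 2)
    (hvar : ∀ t ∈ Icc 0 T, ∫ ω, Y t ω ^ 2 ∂P ≤ σ ^ 2 * (t / T))
    (hcov : ∀ t ∈ Icc 0 T, ∫ ω, Y t ω * Y T ω ∂P ≤ σ ^ 2 - c * (T - t))
    (hB : ∀ t ∈ Icc 0 T, |g t| ≤ B)
    (hν : ν ∈ Ioo 0 T) (hg : ∀ t ∈ Icc ν T, |g T - g t| ≤ M * (T - t)) :
    Tendsto (fun u => (P {ω | u < ⨆ t : Icc (0 : ℝ) T, (Y t ω - g t)}).toReal /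
      stdNormalTail ((u + g T) / σ)) atTop (nhds 1) := by
  have hT : 0 < T := hν.1.trans hν.2
  have hTm : T ∈ Icc 0 T := ⟨hT.le, le_rfl⟩
  obtain ⟨δ, hδ0, hδT, R, hR, hnear⟩ := exists_measureReal_exists_lt_le_stdNormalTail_mul hY hcont
    hα hα2 hC hσ hc hinc hvarT hcov hν hg
  obtain ⟨N, hNm, hN0, ⟨η, hη, hNint⟩, hN⟩ := exists_holder_exp_integrable (P := P) (Y := Y)
    (ρ := (1 + α) / 4) (α := α) (C := C) hT (by linarith) (by linarith) hC hY.1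
    (fun s hs t ht => by
      obtain ⟨w, hw, hwe⟩ := hY.exists_map_sub_eq hs ht
      exact ⟨w, hw, hwe ▸ hinc s hs t ht⟩) hcont
  have hsub : Icc 0 (T - δ) ⊆ Icc 0 T := Icc_subset_Icc_right (by linarith)
  have hfar := tendsto_measureReal_exists_lt_div_stdNormalTail (P := P) (Y := Y) (N := N)
    (a := T - δ) (ρ := (1 + α) / 4) (s := σ ^ 2 * ((T - δ) / T)) (σ := σ) (2 * B) (by linarith) hη
    (mul_pos (by positivity) (div_pos (by linarith) hT)) hσ
    (by
      refine mul_lt_of_lt_one_right (by positivity) ?_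
      rw [div_lt_one hT]
      linarith)
    hN0 hNint (fun t ht => hY.1 t (hsub ht))
    (fun t ht => by
      obtain ⟨w, hw⟩ := hY.exists_map_eq (hsub ht)
      refine ⟨w, hw, ?_⟩
      rw [← integral_sq_of_map_eq_gaussianReal (hY.1 t (hsub ht)) hw]
      refine (hvar t (hsub ht)).trans ?_
      have := ht.2
      gcongr)
    (hN.mono fun ω hω s hs t ht => hω s (hsub hs) t (hsub ht))
  have hlaw : P.map (Y T) = gaussianReal 0 (σ ^ 2).toNNReal := by
    obtain ⟨w, hw⟩ := hY.exists_map_eq hTm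
    rw [hw, ← hvarT, integral_sq_of_map_eq_gaussianReal (hY.1 T hTm) hw, Real.toNNReal_coe]
  have htail : ∀ v, P.real {ω | v < Y T ω} = stdNormalTail (v / σ) := by
    intro v
    have hne : (σ ^ 2).toNNReal ≠ 0 := by simp; positivity
    have h1 : P {ω | v < Y T ω} = P.map (Y T) (Ioi v) :=
      (Measure.map_apply (hY.1 T hTm) measurableSet_Ioi).symm
    rw [measureReal_def, h1, hlaw, gaussianReal_Ioi_eq_stdNormalTail hne,
      ENNReal.toReal_ofReal (stdNormalTail_nonneg _), Real.coe_toNNReal _ (by positivity),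
      Real.sqrt_sq hσ.le]
  have : Nonempty (Icc (0 : ℝ) T) := ⟨⟨T, hTm⟩⟩
  have hbdd : ∀ᵐ ω ∂P, BddAbove (range fun t : Icc (0 : ℝ) T => Y t ω - g t) := by
    filter_upwards [hcont] with ω hω
    obtain ⟨A, hA⟩ := isCompact_Icc.bddAbove_image hω
    refine ⟨A + B, ?_⟩
    rintro _ ⟨t, rfl⟩
    have h1 : Y t ω ≤ A := hA (mem_image_of_mem _ t.2)
    have h2 := neg_le_of_abs_le (hB t t.2)
    change Y t ω - g t ≤ A + B
    linarith
  have hshift : Tendsto (fun u : ℝ => u + g T) atTop atTop :=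
    tendsto_atTop_add_const_right _ _ tendsto_id
  have hup := (hR.add hfar).comp hshift
  rw [add_zero] at hup
  refine tendsto_of_tendsto_of_tendsto_of_le_of_le' tendsto_const_nhds hup ?_ ?_
  · filter_upwards [hshift.eventually_ge_atTop 0] with u hu
    rw [le_div_iff₀ (stdNormalTail_pos_of_nonneg (by positivity)), one_mul, ← htail]
    refine ENNReal.toReal_mono (measure_ne_top _ _) (measure_mono_ae ?_)
    filter_upwards [hbdd] with ω hω hlt
    have h1 := le_ciSup hω ⟨T, hTm⟩
    change u < ⨆ t : Icc (0 : ℝ) T, (Y t ω - g t)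
    change u + g T < Y T ω at hlt
    change Y T ω - g T ≤ _ at h1
    linarith
  · filter_upwards [hshift.eventually_ge_atTop 0, hshift.eventually hnear] with u hu hu2
    have hpos := stdNormalTail_pos_of_nonneg (x := (u + g T) / σ) (by positivity)
    change _ ≤ R (u + g T) + P.real _ / stdNormalTail ((u + g T) / σ)
    rw [div_le_iff₀ hpos, add_mul, div_mul_cancel₀ _ hpos.ne', mul_comm (R _)]
    refine le_trans ?_ (add_le_add_left hu2 _)
    refine le_trans (measureReal_mono ?_) (measureReal_union_le _ _)
    intro ω hω
    obtain ⟨t, ht⟩ := exists_lt_of_lt_ciSup (show u < ⨆ t : Icc (0 : ℝ) T, (Y t ω - g t) from hω)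
    rcases le_total (T - δ) t with h | h
    · exact Or.inl ⟨t, ⟨h, t.2.2⟩, by linarith⟩
    · refine Or.inr ⟨t, ⟨t.2.1, h⟩, ?_⟩
      have h1 := le_of_abs_le (hB T hTm)
      have h2 := neg_le_of_abs_le (hB t t.2)
      linarith

end ExactAsymptotics

section Bifractional

/-- The covariance function of bifractional Brownian motion. -/
noncomputable def bifractionalCov (K H s t : ℝ) : ℝ :=
  (2 : ℝ) ^ (-K) * ((t ^ (2 * H) + s ^ (2 * H)) ^ K - |t - s| ^ (2 * K * H))

variable {K H T : ℝ}

lemma bifractionalCov_self {t : ℝ} (hKH : 0 < K * H) (ht : 0 ≤ t) :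
    bifractionalCov K H t t = t ^ (2 * K * H) := by
  rw [bifractionalCov, sub_self, abs_zero, Real.zero_rpow (by linarith), sub_zero, ← two_mul,
    Real.mul_rpow (by norm_num) (by positivity), ← mul_assoc, ← Real.rpow_add (by norm_num),
    neg_add_cancel, Real.rpow_zero, one_mul, ← Real.rpow_mul ht]
  ring_nf

lemma bifractionalCov_incr_le {s t : ℝ} (hK : K ∈ Ioc (0 : ℝ) 1) (hH : 0 < H) (hs : 0 ≤ s)
    (ht : 0 ≤ t) :
    bifractionalCov K H t t - 2 * bifractionalCov K H s t + bifractionalCov K H s s ≤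
      2 * |t - s| ^ (2 * K * H) := by
  have hKH : 0 < K * H := mul_pos hK.1 hH
  rw [bifractionalCov_self hKH ht, bifractionalCov_self hKH hs, bifractionalCov]
  have hx : t ^ (2 * H) ∈ Ici (0 : ℝ) := mem_Ici.mpr (by positivity)
  have hy : s ^ (2 * H) ∈ Ici (0 : ℝ) := mem_Ici.mpr (by positivity)
  have h1 := (Real.concaveOn_rpow hK.1.le hK.2).2 hx hy
    (by norm_num : (0 : ℝ) ≤ 1 / 2) (by norm_num : (0 : ℝ) ≤ 1 / 2) (by norm_num)
  simp only [smul_eq_mul] at h1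
  rw [← mul_add, ← mul_add, Real.mul_rpow (by norm_num) (by positivity), ← Real.rpow_mul ht,
    ← Real.rpow_mul hs, one_div, Real.inv_rpow (by norm_num), ← Real.rpow_neg (by norm_num),
    show 2 * H * K = 2 * K * H by ring] at h1
  have h2 : (2 : ℝ) ^ (-K) ≤ 1 :=
    Real.rpow_le_one_of_one_le_of_nonpos (by norm_num) (by linarith [hK.1])
  have h3 := mul_le_mul_of_nonneg_right h2
    (by positivity : (0 : ℝ) ≤ |t - s| ^ (2 * K * H))
  linarith

lemma rpow_le_rpow_mul_div {p t : ℝ} (hp : 1 ≤ p) (hT : 0 < T) (ht : t ∈ Icc 0 T) :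
    t ^ p ≤ T ^ p * (t / T) := by
  have h1 : t ^ p = T ^ p * (t / T) ^ p := by
    rw [← Real.mul_rpow hT.le (div_nonneg ht.1 hT.le), mul_div_cancel₀ _ hT.ne']
  rw [h1]
  gcongr
  exact Real.rpow_le_self_of_le_one (div_nonneg ht.1 hT.le) ((div_le_one hT).mpr ht.2) hp

lemma bifractionalCov_le {t : ℝ} (hK : K ∈ Ioc (0 : ℝ) 1) (hH : 1 / 2 ≤ H) (hT : 0 < T)
    (ht : t ∈ Icc 0 T) :
    bifractionalCov K H t T ≤
      T ^ (2 * K * H) - T ^ (2 * K * H) * K / (2 * T) * (T - t) := by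
  have h1 : T ^ (2 * H) + t ^ (2 * H) ≤ T ^ (2 * H) * (2 * (1 + (t / T - 1) / 2)) := by
    have := rpow_le_rpow_mul_div (p := 2 * H) (by linarith) hT ht
    linarith
  have hx0 : 0 ≤ t / T := div_nonneg ht.1 hT.le
  have h2 := rpow_one_add_le_one_add_mul_self (s := (t / T - 1) / 2) (by linarith) hK.1.le hK.2
  have ht0 := ht.1
  have h3 : 0 ≤ |T - t| ^ (2 * K * H) := by positivity
  calc bifractionalCov K H t T ≤ (2 : ℝ) ^ (-K) * (T ^ (2 * H) + t ^ (2 * H)) ^ K := by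
        rw [bifractionalCov]
        gcongr
        linarith
    _ ≤ (2 : ℝ) ^ (-K) * (T ^ (2 * H) * (2 * (1 + (t / T - 1) / 2))) ^ K := by
        have := hK.1.le
        gcongr
    _ = T ^ (2 * K * H) * (1 + (t / T - 1) / 2) ^ K := by
        rw [Real.mul_rpow (by positivity) (by linarith), Real.mul_rpow (by norm_num) (by linarith),
          ← Real.rpow_mul hT.le, Real.rpow_neg (by norm_num)]
        field_simp
    _ ≤ T ^ (2 * K * H) * (1 + K * ((t / T - 1) / 2)) := by gcongr
    _ = _ := by
        field_simp
        ring

end Bifractional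

section WeightedSum

variable {Ω : Type*} [MeasurableSpace Ω] {P : Measure Ω}

lemma iIndepFun_of_iIndep_of_measurable {ι : Type*} {m : ι → MeasurableSpace Ω} {U : ι → Ω → ℝ}
    (hm : iIndep m P) (hU : ∀ i, Measurable[m i] (U i)) : iIndepFun U P :=
  (iIndepFun_iff_iIndep _ _ _).mpr (iIndep_of_iIndep_of_le hm fun i => (hU i).comap_le)

variable {n : ℕ} {T : ℝ} {X : Fin n → ℝ → Ω → ℝ}

lemma measurable_iSup_comap {Ω : Type*} {X : Fin n → ℝ → Ω → ℝ} (i : Fin n) {t : ℝ}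
    (ht : t ∈ Icc 0 T) :
    Measurable[⨆ t : Icc (0 : ℝ) T, MeasurableSpace.comap (X i t) inferInstance] (X i t) :=
  (comap_measurable (X i t)).mono
    (le_iSup (fun t : Icc (0 : ℝ) T => MeasurableSpace.comap (X i t) inferInstance) ⟨t, ht⟩) le_rfl

/-- A weighted sum of independent centered Gaussian processes is a centered Gaussian process. -/
lemma isCenteredGaussianProcess_sum (hGauss : ∀ i, IsCenteredGaussianProcess P T (X i))
    (hindep : iIndep
      (fun i => ⨆ t : Icc (0 : ℝ) T, MeasurableSpace.comap (X i t) inferInstance) P)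
    (lam : Fin n → ℝ) : IsCenteredGaussianProcess P T fun t ω => ∑ i, lam i * X i t ω := by
  refine ⟨fun t ht => Finset.measurable_sum _ fun i _ => ((hGauss i).1 t ht).const_mul _,
    fun k c t ht => ?_⟩
  set U : Fin n → Ω → ℝ := fun i ω => ∑ j, lam i * c j * X i (t j) ω with hU
  have hUm : ∀ i, Measurable (U i) := fun i =>
    Finset.measurable_sum _ fun j _ => ((hGauss i).1 _ (ht j)).const_mul _
  have hUlaw : ∀ i, ∃ v : NNReal, P.map (U i) = gaussianReal 0 v := fun i =>
    (hGauss i).2 k (fun j => lam i * c j) t ht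
  have hUind : iIndepFun U P := by
    refine iIndepFun_of_iIndep_of_measurable hindep fun i => ?_
    exact Finset.measurable_sum _ fun j _ => (measurable_iSup_comap i (ht j)).const_mul _
  have hUG : ∀ i, HasGaussianLaw (U i) P := fun i => by
    obtain ⟨v, hv⟩ := hUlaw i
    exact ⟨by rw [hv]; infer_instance⟩
  have hsum : (fun ω => ∑ j, c j * ∑ i, lam i * X i (t j) ω) = fun ω => ∑ i, U i ω := by
    funext ω
    simp only [hU, Finset.mul_sum]
    rw [Finset.sum_comm]
    refine Finset.sum_congr rfl fun i _ => Finset.sum_congr rfl fun j _ => by ring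
  refine ⟨Var[fun ω => ∑ i, U i ω; P].toNNReal, ?_⟩
  rw [hsum, (hUind.hasGaussianLaw_fun_sum hUG).map_eq_gaussianReal,
    integral_finsetSum _ fun i _ => (hUG i).integrable]
  congr 1
  refine Finset.sum_eq_zero fun i _ => ?_
  obtain ⟨v, hv⟩ := hUlaw i
  exact integral_of_map_eq_gaussianReal (hUm i) hv

lemma integral_weightedSum_mul (hGauss : ∀ i, IsCenteredGaussianProcess P T (X i))
    (hindep : iIndep
      (fun i => ⨆ t : Icc (0 : ℝ) T, MeasurableSpace.comap (X i t) inferInstance) P)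
    (lam : Fin n → ℝ) {s t : ℝ} (hs : s ∈ Icc 0 T) (ht : t ∈ Icc 0 T) :
    ∫ ω, (∑ i, lam i * X i s ω) * (∑ i, lam i * X i t ω) ∂P =
      ∑ i, lam i ^ 2 * ∫ ω, X i s ω * X i t ω ∂P := by
  classical
  have hcross : ∀ i j, i ≠ j → ∫ ω, X i s ω * X j t ω ∂P = 0 := by
    intro i j hij
    have h1 : iIndepFun (fun l => X l (if l = i then s else t)) P := by
      refine iIndepFun_of_iIndep_of_measurable hindep fun l => ?_
      split_ifs
      · exact measurable_iSup_comap l hs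
      · exact measurable_iSup_comap l ht
    have h2 := h1.indepFun hij
    simp only [if_true, hij.symm, if_false] at h2
    rw [h2.integral_fun_mul_eq_mul_integral ((hGauss i).1 s hs).aestronglyMeasurable
      ((hGauss j).1 t ht).aestronglyMeasurable, (hGauss i).integral_eq_zero hs, zero_mul]
  have hint : ∀ i j, Integrable (fun ω => lam i * lam j * (X i s ω * X j t ω)) P := fun i j =>
    Integrable.const_mul (((hGauss i).memLp_two hs).integrable_mul ((hGauss j).memLp_two ht)) _
  have e : ∀ ω, (∑ i, lam i * X i s ω) * (∑ i, lam i * X i t ω) =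
      ∑ i, ∑ j, lam i * lam j * (X i s ω * X j t ω) := fun ω => by
    rw [Finset.sum_mul_sum]
    exact Finset.sum_congr rfl fun i _ => Finset.sum_congr rfl fun j _ => by ring
  simp only [e]
  rw [integral_finsetSum _ fun i _ => integrable_finsetSum _ fun j _ => hint i j]
  refine Finset.sum_congr rfl fun i _ => ?_
  rw [integral_finsetSum _ fun j _ => hint i j, Finset.sum_eq_single i]
  · rw [integral_const_mul, sq]
  · intro j _ hji
    rw [integral_const_mul, hcross i j hji.symm, mul_zero]
  · simp

end WeightedSum

/-- exact asymptotics of the finite-time ruin probability for a weighted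
sum of independent bifractional Brownian motions with `1/2 < K₁H₁ < K₂H₂ ≤ ⋯ ≤ K_nH_n`
(Corollary 3.2 (i) of the paper, case `KH > 1/2`, where the constant equals `1`). -/
theorem stmt16 {Ω : Type*} [MeasurableSpace Ω] (P : Measure Ω) [IsProbabilityMeasure P]
    (T : ℝ) (hT : 0 < T) (n : ℕ) [NeZero n]
    (X : Fin n → ℝ → Ω → ℝ) (K H : Fin n → ℝ)
    (hK : ∀ i, K i ∈ Set.Ioc (0:ℝ) 1) (hH : ∀ i, H i ∈ Set.Ioo (0:ℝ) 1)
    (hKH0 : 1 / 2 < K 0 * H 0)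
    (hKH_first : ∀ i : Fin n, i ≠ 0 → K 0 * H 0 < K i * H i)
    (hKH_mono : ∀ i j : Fin n, i ≠ 0 → i ≤ j → K i * H i ≤ K j * H j)
    (hGauss : ∀ i, IsCenteredGaussianProcess P T (X i))
    (hindep : iIndep
      (fun i => ⨆ t : Set.Icc (0:ℝ) T, MeasurableSpace.comap (X i t) inferInstance) P)
    (hcont : ∀ i, ∀ᵐ ω ∂P, ContinuousOn (fun t => X i t ω) (Set.Icc (0:ℝ) T))
    (hcov : ∀ i, ∀ s ∈ Set.Icc (0:ℝ) T, ∀ t ∈ Set.Icc (0:ℝ) T,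
      ∫ ω, X i s ω * X i t ω ∂P =
        (2:ℝ) ^ (-(K i)) * ((t ^ (2 * H i) + s ^ (2 * H i)) ^ K i -
          |t - s| ^ (2 * K i * H i)))
    (lam : Fin n → ℝ) (hlam : ∀ i, 0 < lam i)
    (g : ℝ → ℝ) (hg_meas : Measurable g)
    (hg_bdd : ∃ B : ℝ, ∀ t ∈ Set.Icc (0:ℝ) T, |g t| ≤ B)
    (M ν : ℝ) (hν : ν ∈ Set.Ioo 0 T)
    (hg : ∀ t ∈ Set.Icc ν T, |g T - g t| ≤ M * (T - t)) :
    Tendsto (fun u =>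
        (P {ω | u < ⨆ t : Set.Icc (0:ℝ) T, (∑ i, lam i * X i t ω - g t)}).toReal /
          stdNormalTail ((u + g T) / Real.sqrt (∑ i, lam i ^ 2 * T ^ (2 * K i * H i))))
      atTop (nhds 1) := by
  obtain ⟨B, hB⟩ := hg_bdd
  have hTT : T ∈ Icc 0 T := right_mem_Icc.mpr hT.le
  have hKHle : ∀ i, K 0 * H 0 ≤ K i * H i := fun i => by
    rcases eq_or_ne i 0 with rfl | hi
    · exact le_rfl
    · exact (hKH_first i hi).le
  have hKHpos : ∀ i, 0 < K i * H i := fun i => mul_pos (hK i).1 (hH i).1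
  have hHhalf : ∀ i, 1 / 2 ≤ H i := fun i => by
    nlinarith [hKHle i, (hK i).2, (hH i).1]
  have hne : (Finset.univ : Finset (Fin n)).Nonempty := ⟨0, Finset.mem_univ 0⟩
  have hvar0 : 0 < ∑ i, lam i ^ 2 * T ^ (2 * K i * H i) :=
    Finset.sum_pos (fun i _ => by have := hlam i; positivity) hne
  have hprod : ∀ s ∈ Icc 0 T, ∀ t ∈ Icc 0 T,
      ∫ ω, (∑ i, lam i * X i s ω) * (∑ i, lam i * X i t ω) ∂P =
        ∑ i, lam i ^ 2 * bifractionalCov (K i) (H i) s t := fun s hs t ht => by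
    rw [integral_weightedSum_mul hGauss hindep lam hs ht]
    refine Finset.sum_congr rfl fun i _ => ?_
    rw [hcov i s hs t ht, bifractionalCov]
  have hsq : ∀ t ∈ Icc 0 T, ∫ ω, (∑ i, lam i * X i t ω) ^ 2 ∂P =
      ∑ i, lam i ^ 2 * t ^ (2 * K i * H i) := fun t ht => by
    simp only [sq (∑ i, _ : ℝ)]
    rw [hprod t ht t ht]
    exact Finset.sum_congr rfl fun i _ => by rw [bifractionalCov_self (hKHpos i) ht.1]
  have hY := isCenteredGaussianProcess_sum hGauss hindep lam
  refine tendsto_measure_lt_iSup_div_stdNormalTail (P := P) (T := T) (B := B) (M := M) (ν := ν)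
    (g := g) (Y := fun t ω => ∑ i, lam i * X i t ω)
    (C := ∑ i, lam i ^ 2 * (2 * T ^ (2 * K i * H i - 2 * K 0 * H 0)))
    (c := ∑ i, lam i ^ 2 * (T ^ (2 * K i * H i) * K i / (2 * T)))
    (σ := √(∑ i, lam i ^ 2 * T ^ (2 * K i * H i)))
    (α := 2 * K 0 * H 0) hY ?_ (by linarith) ?_ ?_ (Real.sqrt_pos.mpr hvar0) ?_ ?_ ?_ ?_ ?_
    hB hν hg
  · filter_upwards [ae_all_iff.mpr hcont] with ω hω
    exact continuousOn_finsetSum _ fun i _ => (hω i).const_smul (lam i)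
  · nlinarith [(hK 0).2, (hH 0).2, (hK 0).1, (hH 0).1]
  · exact Finset.sum_pos (fun i _ => by have := hlam i; positivity) hne
  · exact Finset.sum_pos (fun i _ => by have := hlam i; have := (hK i).1; positivity) hne
  · intro s hs t ht
    have hint : ∀ a ∈ Icc 0 T, ∀ b ∈ Icc 0 T,
        Integrable (fun ω => (∑ i, lam i * X i a ω) * (∑ i, lam i * X i b ω)) P :=
      fun a ha b hb => (hY.memLp_two ha).integrable_mul (hY.memLp_two hb)
    have hsub : Integrable (fun ω => (∑ i, lam i * X i t ω) * (∑ i, lam i * X i t ω) -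
        2 * ((∑ i, lam i * X i s ω) * (∑ i, lam i * X i t ω))) P :=
      (hint t ht t ht).sub ((hint s hs t ht).const_mul 2)
    calc ∫ ω, (∑ i, lam i * X i t ω - ∑ i, lam i * X i s ω) ^ 2 ∂P
        = ∫ ω, ((∑ i, lam i * X i t ω) * (∑ i, lam i * X i t ω) -
            2 * ((∑ i, lam i * X i s ω) * (∑ i, lam i * X i t ω)) +
            (∑ i, lam i * X i s ω) * (∑ i, lam i * X i s ω)) ∂P := by
          congr 1 with ω
          ring
      _ = ∑ i, lam i ^ 2 * (bifractionalCov (K i) (H i) t t -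
            2 * bifractionalCov (K i) (H i) s t + bifractionalCov (K i) (H i) s s) := by
          rw [integral_add hsub (hint s hs s hs),
            integral_sub (hint t ht t ht) ((hint s hs t ht).const_mul 2), integral_const_mul,
            hprod t ht t ht, hprod s hs t ht, hprod s hs s hs, Finset.mul_sum,
            ← Finset.sum_sub_distrib, ← Finset.sum_add_distrib]
          exact Finset.sum_congr rfl fun i _ => by ring
      _ ≤ ∑ i, lam i ^ 2 * (2 * T ^ (2 * K i * H i - 2 * K 0 * H 0)) *
            |t - s| ^ (2 * K 0 * H 0) := by
          refine Finset.sum_le_sum fun i _ => ?_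
          have hle : |t - s| ≤ T := abs_sub_le_iff.mpr ⟨by linarith [ht.2, hs.1],
            by linarith [hs.2, ht.1]⟩
          have hexp : 0 ≤ 2 * K i * H i - 2 * K 0 * H 0 := by linarith [hKHle i]
          have hpow : |t - s| ^ (2 * K i * H i) ≤
              T ^ (2 * K i * H i - 2 * K 0 * H 0) * |t - s| ^ (2 * K 0 * H 0) := by
            calc |t - s| ^ (2 * K i * H i)
                = |t - s| ^ (2 * K i * H i - 2 * K 0 * H 0) * |t - s| ^ (2 * K 0 * H 0) := by
                  rw [← Real.rpow_add_of_nonneg (abs_nonneg _) hexp (by linarith),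
                    sub_add_cancel]
              _ ≤ _ := by gcongr
          rw [mul_assoc]
          refine mul_le_mul_of_nonneg_left ?_ (sq_nonneg _)
          linarith [bifractionalCov_incr_le (hK i) (hH i).1 hs.1 ht.1]
      _ = _ := (Finset.sum_mul _ _ _).symm
  · rw [hsq T hTT, Real.sq_sqrt hvar0.le]
  · intro t ht
    rw [hsq t ht, Real.sq_sqrt hvar0.le, Finset.sum_mul]
    refine Finset.sum_le_sum fun i _ => ?_
    rw [mul_assoc (lam i ^ 2)]
    exact mul_le_mul_of_nonneg_left
      (rpow_le_rpow_mul_div (by linarith [hKHle i]) hT ht) (sq_nonneg _)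
  · intro t ht
    rw [hprod t ht T hTT, Real.sq_sqrt hvar0.le, Finset.sum_mul, ← Finset.sum_sub_distrib]
    refine Finset.sum_le_sum fun i _ => ?_
    rw [mul_assoc (lam i ^ 2), ← mul_sub]
    exact mul_le_mul_of_nonneg_left (bifractionalCov_le (hK i) (hHhalf i) hT ht) (sq_nonneg _)
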